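/- Let R = k[x_1,…,x_d] be a standard graded polynomial ring over an infinite field k, I a homogeneous ideal of R, c an integer with 1 ≤ c ≤ dim(R/I) − 1, ℓ_1,…,ℓ_c general linear forms in R, Ī the image of I in R̄ = R/(ℓ_1,…,ℓ_c), and J = Ī^{sat} the saturation of Ī. Then b_0(J) ≤ max{ b_0(I), b_{d−c−2}(I) − d + c + 1 }. Furthermore, if c = dim(R/I) − 1, then b_0(J) ≤ b_{d−c−2}(I) − d + c + 2. -/

import Mathlib

/-!
Statement 13 (Corollary `hyperplane` of the paper).

`R = k[x₁,…,x_d]` is a standard graded polynomial ring over an infinite field, `I` a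
homogeneous ideal, `1 ≤ c ≤ dim(R/I) − 1`, `ℓ₁,…,ℓ_c` general linear forms,
`R̄ = R/(ℓ₁,…,ℓ_c)`, `Ī` the image of `I` and `J = Ī^sat` the saturation with respect
to the maximal homogeneous ideal `𝔪̄`.  Then

`b₀(J) ≤ max{ b₀(I), b_{d-c-2}(I) − d + c + 1 }`,

and moreover `b₀(J) ≤ b_{d-c-2}(I) − d + c + 2` if `c = dim(R/I) − 1`.

"General linear forms" is rendered as: there is a nonzero polynomial `f` in the
`c × d` matrix of coefficients such that the conclusion holds whenever the coefficient
matrix `Λ` does not annihilate `f`.  The graded Betti bounds `b_j(I) = b_{j+1}(R/I)`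
are rendered via graded free resolutions (`HasResolutionBddBy`), and generator-degree
bounds in the quotient `R̄` are expressed on preimages in `R`.
-/

noncomputable section
namespace Paper

variable {k : Type} [Field k]

abbrev Poly (k : Type) [Field k] (d : ℕ) := MvPolynomial (Fin d) k

def polyPiece (k : Type) [Field k] (d : ℕ) (z : ℤ) : Submodule k (Poly k d) :=
  if 0 ≤ z then MvPolynomial.homogeneousSubmodule (Fin d) k z.toNat else ⊥

/-- The saturation `J^sat = ⋃ᵢ (J :  mI^i)` of `J` with respect to `mI`. -/
def saturation {S : Type} [CommRing S] (J mI : Ideal S) : Ideal S where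
  carrier := { x | ∃ i : ℕ, ∀ y ∈ mI ^ i, y * x ∈ J }
  zero_mem' := ⟨0, fun y _ => by rw [mul_zero]; exact J.zero_mem⟩
  add_mem' := by
    rintro a b ⟨i, hi⟩ ⟨i', hi'⟩
    refine ⟨i + i', fun y hy => ?_⟩
    have h1 : y ∈ mI ^ i := Ideal.pow_le_pow_right (Nat.le_add_right i i') hy
    have h2 : y ∈ mI ^ i' := Ideal.pow_le_pow_right (Nat.le_add_left i' i) hy
    rw [mul_add]
    exact J.add_mem (hi y h1) (hi' y h2)
  smul_mem' := by
    rintro c x ⟨i, hi⟩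
    refine ⟨i, fun y hy => ?_⟩
    rw [smul_eq_mul, mul_comm c x, ← mul_assoc]
    exact J.mul_mem_right c (hi y hy)

def IsGradedFreeResolution {d : ℕ} (N : Type) [AddCommGroup N] [Module (Poly k d) N]
    (𝒩 : ℤ → AddSubgroup N) (m : ℕ → ℕ) (a : ∀ j, Fin (m j) → ℤ)
    (dl : ∀ j, (Fin (m (j + 1)) → Poly k d) →ₗ[Poly k d] (Fin (m j) → Poly k d))
    (π : (Fin (m 0) → Poly k d) →ₗ[Poly k d] N) : Prop :=
  Function.Surjective π ∧ LinearMap.ker π = LinearMap.range (dl 0) ∧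
  (∀ j, LinearMap.ker (dl j) = LinearMap.range (dl (j + 1))) ∧
  (∀ j (s : Fin (m (j + 1))) (i : Fin (m j)),
    dl j (Pi.single s 1) i ∈ polyPiece k d (a (j + 1) s - a j i)) ∧
  (∀ s : Fin (m 0), π (Pi.single s 1) ∈ 𝒩 (a 0 s))

/-- `b_j(N) ≤ c j` for all `j`. -/
def HasResolutionBddBy {d : ℕ} (N : Type) [AddCommGroup N] [Module (Poly k d) N]
    (𝒩 : ℤ → AddSubgroup N) (c : ℕ → ℤ) : Prop :=
  ∃ (m : ℕ → ℕ) (a : ∀ j, Fin (m j) → ℤ)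
    (dl : ∀ j, (Fin (m (j + 1)) → Poly k d) →ₗ[Poly k d] (Fin (m j) → Poly k d))
    (π : (Fin (m 0) → Poly k d) →ₗ[Poly k d] N),
    IsGradedFreeResolution (k := k) (d := d) N 𝒩 m a dl π ∧ ∀ j s, a j s ≤ c j

def quotPiece {d : ℕ} (I : Ideal (Poly k d)) (z : ℤ) : AddSubgroup (Poly k d ⧸ I) :=
  AddSubgroup.map (Ideal.Quotient.mk I).toAddMonoidHom (polyPiece k d z).toAddSubgroup

/-- `b₀(I) ≤ b` for a homogeneous ideal of the polynomial ring. -/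
def IdealGenDegLE {d : ℕ} (J : Ideal (Poly k d)) (b : ℤ) : Prop :=
  J ≤ Ideal.span ((J : Set (Poly k d)) ∩
    ⋃ (j : ℤ) (_ : j ≤ b), (polyPiece k d j : Set (Poly k d)))

section Zigzag

variable {R : Type} [CommRing R]

/-- The ideals `L + (y₀ᵗ, …, y_{j-1}ᵗ)`. -/
def powIdeal (L : Ideal R) (y : ℕ → R) (t : ℕ) : ℕ → Ideal R
  | 0 => L
  | j + 1 => powIdeal L y t j ⊔ Ideal.span {y j ^ t}

variable {L : Ideal R} {y : ℕ → R}

theorem pow_mem_powIdeal {t i j : ℕ} (h : i < j) : y i ^ t ∈ powIdeal L y t j := by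
  induction j with
  | zero => omega
  | succ j ih =>
    rcases Nat.lt_succ_iff_lt_or_eq.1 h with h | rfl
    · exact Ideal.mem_sup_left (ih h)
    · exact Ideal.mem_sup_right (Ideal.mem_span_singleton_self _)

theorem prod_pow_mul_mem_powIdeal {t j : ℕ} (s : ℕ) {a : R} (ha : a ∈ powIdeal L y t j) :
    (∏ l ∈ Finset.range j, y l) ^ s * a ∈ powIdeal L y (t + s) j := by
  induction j generalizing a with
  | zero => exact Ideal.mul_mem_left _ _ ha
  | succ j ih =>
    obtain ⟨b, hb, c, hc, rfl⟩ := Submodule.mem_sup.1 ha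
    obtain ⟨c, rfl⟩ := Ideal.mem_span_singleton'.1 hc
    rw [Finset.prod_range_succ, mul_add]
    refine add_mem (Ideal.mem_sup_left ?_) (Ideal.mem_sup_right ?_)
    · rw [mul_pow, mul_comm _ (y j ^ s), mul_assoc]
      exact Ideal.mul_mem_left _ _ (ih hb)
    · exact Ideal.mem_span_singleton'.2 ⟨(∏ l ∈ Finset.range j, y l) ^ s * c, by ring⟩

section Module

variable {M N : Type} [AddCommGroup M] [Module R M] [AddCommGroup N] [Module R N]

theorem map_mem_smul_top (f : M →ₗ[R] N) {q : Ideal R} {g : M}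
    (hg : g ∈ q • (⊤ : Submodule R M)) : f g ∈ q • (⊤ : Submodule R N) := by
  have h := Submodule.mem_map_of_mem (f := f) hg
  rw [Submodule.map_smul''] at h
  exact Submodule.smul_mono le_rfl le_top h

theorem smul_mem_smul_top_of_forall {q q' : Ideal R} {r : R} (h : ∀ a ∈ q, r * a ∈ q') {g : M}
    (hg : g ∈ q • (⊤ : Submodule R M)) : r • g ∈ q' • (⊤ : Submodule R M) := by
  induction hg using Submodule.smul_induction_on' with
  | smul a ha n hn =>
    rw [smul_smul]
    exact Submodule.smul_mem_smul (h a ha) trivial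
  | add a _ b _ h1 h2 => rw [smul_add]; exact add_mem h1 h2

theorem mem_sup_span_singleton_smul_top {q : Ideal R} {r : R} {g : M} :
    g ∈ (q ⊔ Ideal.span {r}) • (⊤ : Submodule R M) ↔
      ∃ h : M, g - r • h ∈ q • (⊤ : Submodule R M) := by
  rw [Submodule.sup_smul, Submodule.ideal_span_singleton_smul, Submodule.mem_sup]
  constructor
  · rintro ⟨a, ha, b, hb, rfl⟩
    obtain ⟨h, -, rfl⟩ := (Submodule.mem_smul_pointwise_iff_exists _ _ _).1 hb
    exact ⟨h, by simpa using ha⟩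
  · rintro ⟨h, hh⟩
    exact ⟨_, hh, _, Submodule.smul_mem_pointwise_smul h r ⊤ trivial, by simp⟩

end Module

/-- A chain complex of modules with arbitrary terms, indexed by `ℕ`. -/
structure Cplx (R : Type) [CommRing R] where
  obj : ℕ → Type
  [grp : ∀ i, AddCommGroup (obj i)]
  [mod : ∀ i, Module R (obj i)]
  d : ∀ i, obj (i + 1) →ₗ[R] obj i
  d_d : ∀ i g, d i (d (i + 1) g) = 0

attribute [instance] Cplx.grp Cplx.mod

namespace Cplx

/-- The complex obtained by dropping the term in degree zero. -/
def shift (F : Cplx R) : Cplx R where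
  obj i := F.obj (i + 1)
  d i := F.d (i + 1)
  d_d i := F.d_d (i + 1)

/-- The boundaries of the complex `F / q F`, as a submodule of the term `F i`. -/
def bdry (F : Cplx R) (q : Ideal R) (i : ℕ) : Submodule R (F.obj i) :=
  LinearMap.range (F.d i) ⊔ q • ⊤

theorem mem_bdry {F : Cplx R} {q : Ideal R} {i : ℕ} {g : F.obj i} :
    g ∈ F.bdry q i ↔ ∃ h, g - F.d i h ∈ q • (⊤ : Submodule R (F.obj i)) := by
  rw [bdry, Submodule.mem_sup]
  constructor
  · rintro ⟨_, ⟨h, rfl⟩, b, hb, rfl⟩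
    exact ⟨h, by simpa using hb⟩
  · rintro ⟨h, hh⟩
    exact ⟨_, ⟨h, rfl⟩, _, hh, by simp⟩

/-- The sequence `y₀ᵗ, …, y_{n-1}ᵗ` is weakly regular on all terms of `F / L F`. -/
def PowRegular (F : Cplx R) (L : Ideal R) (y : ℕ → R) (n : ℕ) : Prop :=
  ∀ i t j, j < n → ∀ g : F.obj i, y j ^ t • g ∈ powIdeal L y t j • (⊤ : Submodule R (F.obj i)) →
    g ∈ powIdeal L y t j • (⊤ : Submodule R (F.obj i))

/-- In positive degrees, the homology of `F / L F` is torsion with respect to `r`. -/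
def TorsionHomology (F : Cplx R) (L : Ideal R) (r : R) : Prop :=
  ∀ i (z : F.obj (i + 1)), F.d i z ∈ L • (⊤ : Submodule R (F.obj i)) →
    ∃ s : ℕ, r ^ s • z ∈ F.bdry L (i + 1)

/-- `F.Zig L y t j g z` says that the cycle `g` of `F / (L, y₀ᵗ, …, y_{j-1}ᵗ) F` in degree `j` is
carried to `z` by the iterated connecting homomorphism. -/
def Zig (F : Cplx R) (L : Ideal R) (y : ℕ → R) (t : ℕ) : ∀ j, F.obj j → F.obj 0 → Prop
  | 0, g, z => g = z
  | j + 1, g, z => ∃ g' : F.obj j,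
      F.d j g - y j ^ t • g' ∈ powIdeal L y t j • (⊤ : Submodule R (F.obj j)) ∧
        Zig F L y t j g' z

variable {F : Cplx R} {n t : ℕ}

/-- Positive-degree homology of `F / L F` stays torsion when a filter-regular element is added to
`L`. -/
theorem TorsionHomology.sup_span_singleton {r x : R} (hF : F.TorsionHomology L r)
    (hx : ∀ i (g : F.obj i), x • g ∈ L • (⊤ : Submodule R (F.obj i)) →
      g ∈ L • (⊤ : Submodule R (F.obj i)))
    (hx₀ : ∀ g : F.obj 0, x • g ∈ F.bdry L 0 → ∃ s : ℕ, r ^ s • g ∈ F.bdry L 0) :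
    F.TorsionHomology (L ⊔ Ideal.span {x}) r := by
  intro i z hz
  obtain ⟨g, hg⟩ := mem_sup_span_singleton_smul_top.1 hz
  obtain ⟨s, hs⟩ : ∃ s : ℕ, r ^ s • g ∈ F.bdry L i := by
    cases i with
    | zero =>
      refine hx₀ g (Cplx.mem_bdry.2 ⟨z, ?_⟩)
      rwa [← Submodule.neg_mem_iff, neg_sub]
    | succ i =>
      refine hF i g (hx _ _ ?_)
      have := map_mem_smul_top (F.d i) hg
      rwa [map_sub, F.d_d, zero_sub, map_smul, Submodule.neg_mem_iff] at this
  obtain ⟨u, hu⟩ := Cplx.mem_bdry.1 hs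
  obtain ⟨s', hs'⟩ := hF i (r ^ s • z - x • u) (by
    have := add_mem (Submodule.smul_mem _ (r ^ s) hg) (Submodule.smul_mem _ x hu)
    convert this using 1
    simp only [map_sub, map_smul, smul_sub]
    rw [smul_comm x (r ^ s) g]
    abel)
  obtain ⟨w, hw⟩ := Cplx.mem_bdry.1 hs'
  refine ⟨s + s', Cplx.mem_bdry.2 ⟨w, mem_sup_span_singleton_smul_top.2 ⟨r ^ s' • u, ?_⟩⟩⟩
  convert hw using 1
  rw [smul_sub, add_comm s s', pow_add, mul_smul, smul_comm (r ^ s') x u]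
  abel

theorem Zig.smul (r : R) : ∀ {j} {g : F.obj j} {z : F.obj 0}, F.Zig L y t j g z →
    F.Zig L y t j (r • g) (r • z)
  | 0, _, _, h => congrArg (r • ·) h
  | j + 1, g, z, ⟨g', h1, h2⟩ => ⟨r • g', by
      rw [map_smul, smul_comm, ← smul_sub]
      exact Submodule.smul_mem _ _ h1, h2.smul r⟩

theorem Zig.sub : ∀ {j} {g₁ g₂ : F.obj j} {z₁ z₂ : F.obj 0}, F.Zig L y t j g₁ z₁ →
    F.Zig L y t j g₂ z₂ → F.Zig L y t j (g₁ - g₂) (z₁ - z₂)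
  | 0, _, _, _, _, h, h' => congrArg₂ (· - ·) h h'
  | j + 1, _, _, _, _, ⟨g₁, h1, h2⟩, ⟨g₂, h1', h2'⟩ => ⟨g₁ - g₂, by
      have := sub_mem h1 h1'
      rwa [map_sub, smul_sub, sub_sub_sub_comm], h2.sub h2'⟩

theorem PowRegular.shift (hF : F.PowRegular L y n) : F.shift.PowRegular L y n :=
  fun i => hF (i + 1)

theorem TorsionHomology.shift {r : R} (hF : F.TorsionHomology L r) :
    F.shift.TorsionHomology L r :=
  fun i => hF (i + 1)

theorem exists_zig_shift (hF : F.PowRegular L y n) {j : ℕ} (hj : j ≤ n) (g : F.obj (j + 1))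
    (hg : F.d j g ∈ powIdeal L y t j • (⊤ : Submodule R (F.obj j))) :
    ∃ z : F.obj 1, F.shift.Zig L y t j g z ∧ F.d 0 z ∈ L • (⊤ : Submodule R (F.obj 0)) := by
  induction j with
  | zero => exact ⟨g, rfl, hg⟩
  | succ j ih =>
    obtain ⟨g', hg'⟩ := mem_sup_span_singleton_smul_top.1 hg
    have h := map_mem_smul_top (F.d j) hg'
    rw [map_sub, F.d_d, zero_sub, map_smul, Submodule.neg_mem_iff] at h
    obtain ⟨z, h1, h2⟩ := ih (by omega) g' (hF _ _ _ (by omega) _ h)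
    exact ⟨z, ⟨g', hg', h1⟩, h2⟩

theorem exists_zig (hF : F.PowRegular L y n) {j : ℕ} (hj : j + 1 ≤ n) (g : F.obj (j + 1))
    (hg : F.d j g ∈ powIdeal L y t (j + 1) • (⊤ : Submodule R (F.obj j))) :
    ∃ z : F.obj 0, F.Zig L y t (j + 1) g z := by
  induction j with
  | zero =>
    obtain ⟨g', hg'⟩ := mem_sup_span_singleton_smul_top.1 hg
    exact ⟨g', g', hg', rfl⟩
  | succ j ih =>
    obtain ⟨g', hg'⟩ := mem_sup_span_singleton_smul_top.1 hg
    have h := map_mem_smul_top (F.d j) hg'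
    rw [map_sub, F.d_d, zero_sub, map_smul, Submodule.neg_mem_iff] at h
    obtain ⟨z, hz⟩ := ih (by omega) g' (hF _ _ _ (by omega) _ h)
    exact ⟨z, g', hg', hz⟩

theorem Zig.mem_bdry (hF : F.PowRegular L y n) {j : ℕ} (hj : j ≤ n) {g : F.obj j} {z : F.obj 0}
    (h : F.Zig L y t j g z) (hg : g ∈ F.bdry (powIdeal L y t j) j) : z ∈ F.bdry L 0 := by
  induction j with
  | zero => exact (show g = z from h) ▸ hg
  | succ j ih =>
    obtain ⟨g', h1, h2⟩ := h
    obtain ⟨u, hu⟩ := Cplx.mem_bdry.1 hg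
    obtain ⟨v, hv⟩ := mem_sup_span_singleton_smul_top.1 hu
    have hv := map_mem_smul_top (F.d j) hv
    rw [map_sub, map_sub, F.d_d, sub_zero, map_smul] at hv
    have := sub_mem hv h1
    rw [sub_sub_sub_cancel_left, ← smul_sub] at this
    exact ih (by omega) h2 (Cplx.mem_bdry.2 ⟨v, hF _ _ _ (by omega) _ this⟩)

theorem Zig.prod_pow_smul (s : ℕ) : ∀ {j} {g : F.obj j} {z : F.obj 0}, F.Zig L y t j g z →
    F.Zig L y (t + s) j ((∏ l ∈ Finset.range j, y l) ^ s • g) z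
  | 0, g, z, h => by simpa [Zig] using h
  | j + 1, g, z, ⟨g', h1, h2⟩ => ⟨(∏ l ∈ Finset.range j, y l) ^ s • g', by
      have : (∏ l ∈ Finset.range (j + 1), y l) ^ s • (F.d j g - y j ^ t • g') ∈
          powIdeal L y (t + s) j • (⊤ : Submodule R (F.obj j)) := by
        rw [Finset.prod_range_succ, mul_pow, mul_comm, mul_smul]
        exact Submodule.smul_mem _ _
          (smul_mem_smul_top_of_forall (fun a => prod_pow_mul_mem_powIdeal s) h1)
      convert this using 1
      rw [smul_sub, map_smul, smul_smul, smul_smul, Finset.prod_range_succ]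
      ring_nf, h2.prod_pow_smul s⟩

theorem Zig.torsion {j : ℕ} (hj : j ≤ n) {r : R} {F : Cplx R} (hF : F.PowRegular L y n)
    (hT : F.TorsionHomology L r) {t : ℕ}
    {g : F.obj j} {z : F.obj 0} (h : F.Zig L y t j g z) (hz : ∃ s : ℕ, r ^ s • z ∈ F.bdry L 0) :
    ∃ s : ℕ, (r ^ s * (∏ l ∈ Finset.range j, y l) ^ s) • g ∈ F.bdry (powIdeal L y (t + s) j) j := by
  induction j generalizing F t with
  | zero =>
    obtain ⟨s, hs⟩ := hz
    refine ⟨s, ?_⟩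
    obtain rfl : g = z := h
    simpa [powIdeal] using hs
  | succ j ih =>
    obtain ⟨g', h1, h2⟩ := h
    obtain ⟨s, hs⟩ := ih (by omega) hF hT h2 hz
    obtain ⟨u, hu⟩ := Cplx.mem_bdry.1 hs
    set Y := ∏ l ∈ Finset.range j, y l with hY
    have hv : F.d j ((r ^ s * Y ^ s) • g - y j ^ t • u) ∈
        powIdeal L y (t + s) j • (⊤ : Submodule R (F.obj j)) := by
      have e1 : (r ^ s * Y ^ s) • (F.d j g - y j ^ t • g') ∈
          powIdeal L y (t + s) j • (⊤ : Submodule R (F.obj j)) := by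
        rw [mul_smul]
        exact Submodule.smul_mem _ _
          (smul_mem_smul_top_of_forall (fun a => prod_pow_mul_mem_powIdeal s) h1)
      have e2 := add_mem e1 (Submodule.smul_mem _ (y j ^ t) hu)
      convert e2 using 1
      simp only [map_sub, map_smul, smul_sub]
      rw [smul_comm (y j ^ t) (r ^ s * Y ^ s) g']
      abel
    obtain ⟨z', hz1, hz2⟩ := exists_zig_shift hF (by omega) _ hv
    obtain ⟨s', hs'⟩ := ih (by omega) hF.shift hT.shift hz1 (hT 0 z' hz2)
    obtain ⟨w, hw⟩ : ∃ w : F.obj (j + 1 + 1),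
        (r ^ s' * Y ^ s') • ((r ^ s * Y ^ s) • g - y j ^ t • u) - F.d (j + 1) w ∈
          powIdeal L y (t + s + s') j • (⊤ : Submodule R (F.obj (j + 1))) :=
      Cplx.mem_bdry.1 hs'
    refine ⟨s + s', Cplx.mem_bdry.2 ⟨y j ^ (s + s') • w, mem_sup_span_singleton_smul_top.2
      ⟨(r ^ s' * Y ^ s') • u, ?_⟩⟩⟩
    rw [← add_assoc]
    have e3 := Submodule.smul_mem _ (y j ^ (s + s')) hw
    convert e3 using 1
    rw [Finset.prod_range_succ, ← hY]
    rw [map_smul (F.d (j + 1))]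
    simp only [smul_sub, smul_smul]
    ring_nf
    abel

theorem Zig.lift (hF : F.PowRegular L y n) {j : ℕ} (hj : j < n)
    (hT : F.TorsionHomology L (y j)) {g : F.obj j} {z : F.obj 0}
    (h : F.Zig L y t j g z) (hz : ∃ s : ℕ, y j ^ s • z ∈ F.bdry L 0) :
    ∃ t' g', F.Zig L y t' (j + 1) g' z := by
  obtain ⟨s, hs⟩ := Zig.torsion hj.le hF hT h hz
  obtain ⟨u, hu⟩ := Cplx.mem_bdry.1 hs
  refine ⟨t + s, y j ^ t • u, _, ?_, h.prod_pow_smul s⟩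
  have := Submodule.smul_mem _ (-(y j ^ t)) hu
  convert this using 1
  rw [smul_sub, map_smul, neg_smul, neg_smul, smul_smul, smul_smul]
  ring_nf
  abel

theorem exists_zig_of_torsion (hF : F.PowRegular L y n)
    (hT : ∀ j < n, F.TorsionHomology L (y j)) {z : F.obj 0}
    (hz : ∀ j < n, ∃ s : ℕ, y j ^ s • z ∈ F.bdry L 0) {j : ℕ} (hj : j ≤ n) :
    ∃ t g, F.Zig L y t j g z := by
  induction j with
  | zero => exact ⟨0, z, rfl⟩
  | succ j ih =>
    obtain ⟨t, g, h⟩ := ih (by omega)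
    exact h.lift hF (by omega) (hT j (by omega)) (hz j (by omega))

theorem Zig.torsion_right (hF : F.PowRegular L y n) {j : ℕ} (hj : j ≤ n) {g : F.obj j}
    {z : F.obj 0} (h : F.Zig L y t j g z) {i : ℕ} (hi : i < j) : y i ^ t • z ∈ F.bdry L 0 :=
  (h.smul (y i ^ t)).mem_bdry hF hj
    (Submodule.mem_sup_right (Submodule.smul_mem_smul (pow_mem_powIdeal hi) trivial))

/-- A grading of the complex `F`, given by the projections onto the homogeneous components, for
which the `y i` have degree one and the ideal `L` is homogeneous. -/
structure Grading (F : Cplx R) (L : Ideal R) (y : ℕ → R) where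
  proj : ∀ i, ℤ → F.obj i →+ F.obj i
  proj_d : ∀ i D g, proj i D (F.d i g) = F.d i (proj (i + 1) D g)
  proj_smul : ∀ i j D g, proj i (D + 1) (y j • g) = y j • proj i D g
  proj_mem : ∀ i D g, g ∈ L • (⊤ : Submodule R (F.obj i)) →
    proj i D g ∈ L • (⊤ : Submodule R (F.obj i))
  proj_proj : ∀ i D g, proj i D (proj i D g) = proj i D g

namespace Grading

variable (P : F.Grading L y)

theorem proj_pow_smul (i j : ℕ) (D : ℤ) (t : ℕ) (g : F.obj i) :
    P.proj i (D + t) (y j ^ t • g) = y j ^ t • P.proj i D g := by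
  induction t with
  | zero => simp
  | succ t ih =>
    rw [pow_succ', mul_smul, mul_smul, ← ih, Nat.cast_succ, ← add_assoc, P.proj_smul]

theorem proj_mem_powIdeal (i j : ℕ) (D : ℤ) {g : F.obj i}
    (hg : g ∈ powIdeal L y t j • (⊤ : Submodule R (F.obj i))) :
    P.proj i D g ∈ powIdeal L y t j • (⊤ : Submodule R (F.obj i)) := by
  induction j generalizing g with
  | zero => exact P.proj_mem i D g hg
  | succ j ih =>
    obtain ⟨h, hh⟩ := mem_sup_span_singleton_smul_top.1 hg
    refine mem_sup_span_singleton_smul_top.2 ⟨P.proj i (D - t) h, ?_⟩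
    rw [← P.proj_pow_smul, sub_add_cancel, ← map_sub]
    exact ih hh

theorem zig (P : F.Grading L y) : ∀ {j} {g : F.obj j} {z : F.obj 0} (D : ℤ), F.Zig L y t j g z →
    F.Zig L y t j (P.proj j (D + j * t) g) (P.proj 0 D z)
  | 0, g, z, D, h => by
    obtain rfl : g = z := h
    simp [Zig]
  | j + 1, g, z, D, ⟨g', h1, h2⟩ => ⟨P.proj j (D + j * t) g', by
      have := P.proj_mem_powIdeal j j (D + (j + 1 : ℕ) * t) h1
      rw [map_sub, P.proj_d] at this
      rwa [← P.proj_pow_smul, add_assoc, ← add_one_mul, ← Nat.cast_succ], P.zig D h2⟩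

/-- The torsion of `H₀(F / L F)` vanishes in degrees where top local cohomology of `Fₙ / L Fₙ`
does. -/
theorem mem_bdry_of_torsion (hF : F.PowRegular L y n)
    (hT : ∀ j < n, F.TorsionHomology L (y j)) {D : ℤ}
    (hD : ∀ t (g : F.obj n), P.proj n (D + n * t) g ∈
      powIdeal L y t n • (⊤ : Submodule R (F.obj n)))
    {z : F.obj 0} (hz : ∀ j < n, ∃ s : ℕ, y j ^ s • z ∈ F.bdry L 0) (hzD : P.proj 0 D z = z) :
    z ∈ F.bdry L 0 := by
  obtain ⟨t, g, h⟩ := exists_zig_of_torsion hF hT hz le_rfl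
  have := P.zig D h
  rw [hzD] at this
  exact this.mem_bdry hF le_rfl (Submodule.mem_sup_right (hD t g))

/-- The torsion of `H₀(F / L F)` has no minimal generators in degrees above those where the top
local cohomology of `F_{n-1} / L F_{n-1}` is nonzero, shifted by one. -/
theorem exists_smul_of_torsion (hF : F.PowRegular L y (n + 1))
    (hT : ∀ j < n + 1, F.TorsionHomology L (y j)) {D : ℤ}
    (hD : ∀ t (g : F.obj n), P.proj n (D - 1 + (n + 1 : ℕ) * t) g ∈
      powIdeal L y t (n + 1) • (⊤ : Submodule R (F.obj n)))
    {z : F.obj 0} (hz : ∀ j < n + 1, ∃ s : ℕ, y j ^ s • z ∈ F.bdry L 0)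
    (hzD : P.proj 0 D z = z) :
    ∃ z', z - y 0 • z' ∈ F.bdry L 0 ∧ (∀ j < n + 1, ∃ s : ℕ, y j ^ s • z' ∈ F.bdry L 0) ∧
      P.proj 0 (D - 1) z' = z' := by
  obtain ⟨t, g, h⟩ := exists_zig_of_torsion hF hT hz le_rfl
  have hg := P.zig D h
  rw [hzD] at hg
  have h0 := hg.prod_pow_smul 1
  rw [pow_one, Finset.prod_range_succ'] at h0
  set w := (∏ l ∈ Finset.range n, y (l + 1)) •
    P.proj (n + 1) (D + (n + 1 : ℕ) * t) g with hw
  have aux : ∀ m : ℕ, (∏ l ∈ Finset.range m, y (l + 1)) •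
      P.proj (n + 1) (D + (n + 1 : ℕ) * t) g = P.proj (n + 1) (D + (n + 1 : ℕ) * t + m)
        ((∏ l ∈ Finset.range m, y (l + 1)) • g) := by
    intro m
    induction m with
    | zero => simp
    | succ m ih =>
      rw [Finset.prod_range_succ, mul_comm, mul_smul, mul_smul, ih, ← P.proj_smul]
      push_cast
      rw [add_assoc _ (m : ℤ) 1]
  have hdw : F.d n w ∈ powIdeal L y (t + 1) (n + 1) • (⊤ : Submodule R (F.obj n)) := by
    have := hD (t + 1) (F.d n ((∏ l ∈ Finset.range n, y (l + 1)) • g))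
    rw [P.proj_d] at this
    rw [hw, aux]
    convert this using 4
    push_cast
    ring
  obtain ⟨z', hz'⟩ := exists_zig hF le_rfl w hdw
  have hz'' := P.zig (D - 1) hz'
  have e : P.proj (n + 1) (D - 1 + (n + 1 : ℕ) * (t + 1 : ℕ)) w = w := by
    rw [hw, aux]
    have : D - 1 + (n + 1 : ℕ) * (t + 1 : ℕ) = D + (n + 1 : ℕ) * t + n := by push_cast; ring
    rw [this, P.proj_proj]
  rw [e] at hz''
  refine ⟨P.proj 0 (D - 1) z', ?_, fun j hj => ⟨t + 1, ?_⟩, P.proj_proj _ _ _⟩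
  · refine (h0.sub (hz''.smul (y 0))).mem_bdry hF le_rfl ?_
    rw [mul_comm, mul_smul, sub_self]
    exact zero_mem _
  · exact hz''.torsion_right hF le_rfl hj

end Grading

end Cplx

end Zigzag

section Coordinates

variable {K : Type} [Field K] {d : ℕ}

open MvPolynomial

/-- The monomial ideal generated by the powers `x_l ^ w l` with `l < p`. -/
def varPowIdeal (K : Type) [Field K] (d : ℕ) (w : ℕ → ℕ) (p : ℕ) : Ideal (MvPolynomial (Fin d) K) :=
  Ideal.span ((fun l : Fin d => X l ^ w l) '' {l | l.1 < p})

theorem mem_varPowIdeal {w : ℕ → ℕ} {p : ℕ} {g : MvPolynomial (Fin d) K} :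
    g ∈ varPowIdeal K d w p ↔ ∀ e ∈ g.support, ∃ l : Fin d, l.1 < p ∧ w l ≤ e l := by
  have h : (fun l : Fin d => (X l : MvPolynomial (Fin d) K) ^ w l) '' {l | l.1 < p} =
      (fun s => monomial s (1 : K)) '' ((fun l : Fin d => Finsupp.single l (w l)) '' {l | l.1 < p}) := by
    rw [Set.image_image]
    simp only [X_pow_eq_monomial]
  rw [varPowIdeal, h, mem_ideal_span_monomial_image]
  simp [Finsupp.single_le_iff]

theorem varPowIdeal_zero (w : ℕ → ℕ) : varPowIdeal K d w 0 = ⊥ := by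
  simp [varPowIdeal]

theorem varPowIdeal_congr {w w' : ℕ → ℕ} {p : ℕ} (h : ∀ l < p, w l = w' l) :
    varPowIdeal K d w p = varPowIdeal K d w' p := by
  rw [varPowIdeal, varPowIdeal]
  congr 1
  exact Set.image_congr fun l hl => by rw [h _ hl]

theorem mem_varPowIdeal_of_pow_mul_mem {w : ℕ → ℕ} {l : Fin d} {t : ℕ}
    {g : MvPolynomial (Fin d) K} (hg : X l ^ t * g ∈ varPowIdeal K d w l) :
    g ∈ varPowIdeal K d w l := by
  rw [mem_varPowIdeal] at hg ⊢
  intro e he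
  obtain ⟨l', hl', hw⟩ := hg (Finsupp.single l t + e) (by
    rw [mem_support_iff] at he ⊢
    rwa [X_pow_eq_monomial, coeff_monomial_mul, one_mul])
  refine ⟨l', hl', ?_⟩
  have hne : l ≠ l' := by rintro rfl; exact lt_irrefl _ hl'
  simpa [hne] using hw

theorem mem_varPowIdeal_of_isHomogeneous {w : ℕ → ℕ} {g : MvPolynomial (Fin d) K} {N : ℕ}
    (hg : g.IsHomogeneous N) (hN : ∑ l : Fin d, ((w l : ℤ) - 1) < N) :
    g ∈ varPowIdeal K d w d := by
  rw [mem_varPowIdeal]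
  intro e he
  by_contra! h
  have h1 : ∑ l : Fin d, (e l : ℤ) ≤ ∑ l : Fin d, ((w l : ℤ) - 1) :=
    Finset.sum_le_sum fun l _ => by have := h l l.2; omega
  have h2 : ∑ l : Fin d, e l = N := by
    rw [← hg (mem_support_iff.1 he), Finsupp.weight_apply, Finsupp.sum_fintype] <;> simp
  rw [← h2] at hN
  push_cast at hN
  omega

/-- The substitution `x_l ↦ ∑ⱼ G l j xⱼ`. -/
def linSubst (G : Matrix (Fin d) (Fin d) K) :
    MvPolynomial (Fin d) K →ₐ[K] MvPolynomial (Fin d) K :=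
  aeval fun l => ∑ j, C (G l j) * X j

theorem linSubst_X (G : Matrix (Fin d) (Fin d) K) (l : Fin d) :
    linSubst G (X l) = ∑ j, C (G l j) * X j :=
  aeval_X _ _

theorem linSubst_comp (G H : Matrix (Fin d) (Fin d) K) :
    (linSubst G).comp (linSubst H) = linSubst (H * G) := by
  refine algHom_ext fun l => ?_
  rw [AlgHom.comp_apply, linSubst_X, linSubst_X, map_sum]
  simp only [map_mul, linSubst_X, Matrix.mul_apply, map_sum, Finset.mul_sum, Finset.sum_mul]
  rw [Finset.sum_comm]
  refine Finset.sum_congr rfl fun i _ => Finset.sum_congr rfl fun j _ => ?_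
  rw [show linSubst G (C (H l j)) = C (H l j) from AlgHom.commutes _ _, mul_assoc]

theorem linSubst_one : linSubst (1 : Matrix (Fin d) (Fin d) K) = AlgHom.id K _ := by
  refine algHom_ext fun l => ?_
  rw [linSubst_X, Finset.sum_eq_single l]
  · simp
  · intro j _ hj
    simp [Matrix.one_apply_ne' hj]
  · simp

theorem isHomogeneous_sum_C_mul_X (v : Fin d → K) :
    (∑ j, C (v j) * X j : MvPolynomial (Fin d) K).IsHomogeneous 1 :=
  IsHomogeneous.sum _ _ _ fun j _ => by simpa using (isHomogeneous_C _ (v j)).mul (isHomogeneous_X K j)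

theorem isHomogeneous_linSubst (G : Matrix (Fin d) (Fin d) K)
    {g : MvPolynomial (Fin d) K} {N : ℕ} (hg : g.IsHomogeneous N) :
    (linSubst G g).IsHomogeneous N := by
  have := hg.aeval _ fun l => isHomogeneous_sum_C_mul_X (G l)
  rwa [one_mul] at this

/-- Linear coordinates on the polynomial ring. -/
structure LinearCoords (K : Type) [Field K] (d : ℕ) where
  toEquiv : MvPolynomial (Fin d) K ≃ₐ[K] MvPolynomial (Fin d) K
  isHomogeneous_symm : ∀ g N, g.IsHomogeneous N → (toEquiv.symm g).IsHomogeneous N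
  isHomogeneous_X : ∀ l, (toEquiv (X l)).IsHomogeneous 1

namespace LinearCoords

variable (ψ : LinearCoords K d)

/-- The `l`-th coordinate function, extended by zero. -/
def coord (l : ℕ) : MvPolynomial (Fin d) K := if h : l < d then ψ.toEquiv (X ⟨l, h⟩) else 0

theorem coord_val (l : Fin d) : ψ.coord l = ψ.toEquiv (X l) := dif_pos l.2

theorem isHomogeneous_coord (l : ℕ) : (ψ.coord l).IsHomogeneous 1 := by
  rw [coord]
  split_ifs
  · exact ψ.isHomogeneous_X _
  · exact isHomogeneous_zero _ _ _

/-- The ideal generated by the powers `(ψ x_l) ^ w l` with `l < p`. -/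
def powersIdeal (w : ℕ → ℕ) (p : ℕ) : Ideal (MvPolynomial (Fin d) K) :=
  (varPowIdeal K d w p).comap ψ.toEquiv.symm.toRingEquiv.toRingHom

theorem powersIdeal_zero (w : ℕ → ℕ) : ψ.powersIdeal w 0 = ⊥ := by
  rw [powersIdeal, varPowIdeal_zero]
  exact Ideal.comap_bot_of_injective _ ψ.toEquiv.symm.injective

theorem powersIdeal_eq_span (w : ℕ → ℕ) (p : ℕ) : ψ.powersIdeal w p =
    Ideal.span ((fun l : Fin d => ψ.coord l ^ w l) '' {l | l.1 < p}) := by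
  rw [powersIdeal]
  have := Ideal.comap_symm (I := varPowIdeal K d w p) ψ.toEquiv.toRingEquiv
  refine this.trans ?_
  rw [varPowIdeal, Ideal.map_span, Set.image_image]
  simp [coord_val]

theorem powersIdeal_succ (w : ℕ → ℕ) {l : ℕ} (hl : l < d) :
    ψ.powersIdeal w (l + 1) = ψ.powersIdeal w l ⊔ Ideal.span {ψ.coord l ^ w l} := by
  have : {l' : Fin d | l'.1 < l + 1} = insert ⟨l, hl⟩ {l' : Fin d | l'.1 < l} := by
    ext l'
    simp [Fin.ext_iff, le_iff_eq_or_lt]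
  rw [powersIdeal_eq_span, this, Set.image_insert_eq, Ideal.span_insert, sup_comm,
    powersIdeal_eq_span]

theorem powersIdeal_congr {w w' : ℕ → ℕ} {p : ℕ} (h : ∀ l < p, w l = w' l) :
    ψ.powersIdeal w p = ψ.powersIdeal w' p := by
  rw [powersIdeal, powersIdeal, varPowIdeal_congr h]

theorem mem_powersIdeal_of_pow_mul_mem {w : ℕ → ℕ} {l : ℕ} (hl : l < d) {t : ℕ}
    {g : MvPolynomial (Fin d) K} (hg : ψ.coord l ^ t * g ∈ ψ.powersIdeal w l) :
    g ∈ ψ.powersIdeal w l := by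
  refine mem_varPowIdeal_of_pow_mul_mem (l := ⟨l, hl⟩) (t := t) ?_
  have h : ψ.toEquiv.symm (ψ.coord l ^ t * g) ∈ varPowIdeal K d w l := hg
  rwa [map_mul, map_pow, coord, dif_pos hl, AlgEquiv.symm_apply_apply] at h

theorem mem_powersIdeal_of_isHomogeneous {w : ℕ → ℕ} {g : MvPolynomial (Fin d) K} {N : ℕ}
    (hg : g.IsHomogeneous N) (hN : ∑ l : Fin d, ((w l : ℤ) - 1) < N) :
    g ∈ ψ.powersIdeal w d :=
  mem_varPowIdeal_of_isHomogeneous (ψ.isHomogeneous_symm g N hg) hN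

/-- The ideal generated by the first `p` coordinates. -/
def linIdeal (p : ℕ) : Ideal (MvPolynomial (Fin d) K) := ψ.powersIdeal (fun _ => 1) p

theorem powIdeal_linIdeal {c t j : ℕ} (h : c + j ≤ d) :
    powIdeal (ψ.linIdeal c) (fun l => ψ.coord (c + l)) t j =
      ψ.powersIdeal (fun l => if l < c then 1 else t) (c + j) := by
  induction j with
  | zero => exact ψ.powersIdeal_congr fun l hl => (if_pos hl).symm
  | succ j ih =>
    rw [powIdeal, ih (by omega), ← add_assoc, ψ.powersIdeal_succ _ (by omega), if_neg (by omega)]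

theorem mem_powIdeal_of_pow_mul_mem {c t j : ℕ} (h : c + j < d) {g : MvPolynomial (Fin d) K}
    (hg : ψ.coord (c + j) ^ t * g ∈ powIdeal (ψ.linIdeal c) (fun l => ψ.coord (c + l)) t j) :
    g ∈ powIdeal (ψ.linIdeal c) (fun l => ψ.coord (c + l)) t j := by
  rw [ψ.powIdeal_linIdeal h.le] at hg ⊢
  exact ψ.mem_powersIdeal_of_pow_mul_mem h hg

theorem mem_powIdeal_of_isHomogeneous {c n t : ℕ} (h : c + n = d) {g : MvPolynomial (Fin d) K}
    {N : ℕ} (hg : g.IsHomogeneous N) (hN : (n : ℤ) * (t - 1) < N) :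
    g ∈ powIdeal (ψ.linIdeal c) (fun l => ψ.coord (c + l)) t n := by
  subst h
  rw [ψ.powIdeal_linIdeal le_rfl]
  refine ψ.mem_powersIdeal_of_isHomogeneous hg (lt_of_eq_of_lt ?_ hN)
  rw [Fin.sum_univ_add]
  simp [mul_sub]

/-- The linear coordinates given by the rows of an invertible matrix. -/
def ofMatrix (G : Matrix (Fin d) (Fin d) K) (hG : IsUnit G.det) : LinearCoords K d where
  toEquiv := AlgEquiv.ofAlgHom (linSubst G) (linSubst G⁻¹)
    (by rw [linSubst_comp, Matrix.nonsing_inv_mul _ hG, linSubst_one])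
    (by rw [linSubst_comp, Matrix.mul_nonsing_inv _ hG, linSubst_one])
  isHomogeneous_symm _ _ hg := isHomogeneous_linSubst _ hg
  isHomogeneous_X _ := isHomogeneous_linSubst _ (MvPolynomial.isHomogeneous_X _ _)

theorem exists_coord_eq {p : ℕ} (hp : p ≤ d) (v : Fin p → Fin d → K)
    (hv : (Matrix.of fun i j : Fin p => v i (j.castLE hp)).det ≠ 0) :
    ∃ ψ : LinearCoords K d, ∀ i : Fin p, ψ.coord i = ∑ j, C (v i j) * X j := by
  obtain ⟨r, rfl⟩ := Nat.exists_eq_add_of_le hp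
  let G : Matrix (Fin (p + r)) (Fin (p + r)) K := Matrix.reindex finSumFinEquiv finSumFinEquiv
    (Matrix.fromBlocks (Matrix.of fun i j : Fin p => v i (j.castLE hp))
      (Matrix.of fun (i : Fin p) (j : Fin r) => v i (Fin.natAdd p j)) 0 1)
  have hG : G.det ≠ 0 := by
    rw [Matrix.det_reindex_self, Matrix.det_fromBlocks_zero₂₁, Matrix.det_one, mul_one]
    exact hv
  refine ⟨ofMatrix G (isUnit_iff_ne_zero.2 hG), fun i => ?_⟩
  rw [coord, dif_pos (i.2.trans_le hp)]
  change linSubst G (X _) = _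
  rw [linSubst_X]
  refine Finset.sum_congr rfl fun j _ => ?_
  congr 2
  have hi : (⟨i, i.2.trans_le hp⟩ : Fin (p + r)) = Fin.castAdd r i := rfl
  rw [hi]
  refine Fin.addCases (fun j => ?_) (fun j => ?_) j
  · simp only [G, Matrix.reindex_apply, Matrix.submatrix_apply, finSumFinEquiv_symm_apply_castAdd,
      Matrix.fromBlocks_apply₁₁]
    rfl
  · simp [G]

end LinearCoords

end Coordinates

section GradedPieces

variable {d : ℕ}

open MvPolynomial

/-- The homogeneous component of a polynomial in an integral degree. -/
def homComp (z : ℤ) : Poly k d →ₗ[k] Poly k d :=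
  if 0 ≤ z then homogeneousComponent z.toNat else 0

theorem mem_polyPiece_iff {z : ℤ} {p : Poly k d} :
    p ∈ polyPiece k d z ↔ (∃ n : ℕ, z = n ∧ p.IsHomogeneous n) ∨ p = 0 := by
  rw [polyPiece]
  split_ifs with h
  · lift z to ℕ using h
    rw [Int.toNat_natCast, mem_homogeneousSubmodule]
    constructor
    · exact fun hp => Or.inl ⟨z, rfl, hp⟩
    · rintro (⟨n, hn, hp⟩ | rfl)
      · rwa [Nat.cast_inj.1 hn]
      · exact isHomogeneous_zero _ _ _
  · rw [Submodule.mem_bot]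
    constructor
    · exact Or.inr
    · rintro (⟨n, rfl, -⟩ | rfl)
      · exact absurd (Int.natCast_nonneg n) h
      · rfl

theorem homComp_natCast (n : ℕ) (p : Poly k d) : homComp (n : ℤ) p = homogeneousComponent n p := by
  simp [homComp]

theorem homComp_of_neg {z : ℤ} (hz : z < 0) (p : Poly k d) : homComp z p = 0 := by
  simp [homComp, not_le.2 hz]

theorem homComp_mem (z : ℤ) (p : Poly k d) : homComp z p ∈ polyPiece k d z := by
  rw [homComp, polyPiece]
  split_ifs
  · exact homogeneousComponent_mem _ _
  · exact zero_mem _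

theorem homComp_of_isHomogeneous {z : ℤ} {n : ℕ} {p : Poly k d} (hp : p.IsHomogeneous n) :
    homComp z p = if z = n then p else 0 := by
  rcases lt_or_ge z 0 with h | h
  · rw [homComp_of_neg h, if_neg (by omega)]
  · lift z to ℕ using h
    rw [homComp_natCast, homogeneousComponent_of_mem hp]
    simp

theorem homComp_of_mem {z : ℤ} {p : Poly k d} (hp : p ∈ polyPiece k d z) : homComp z p = p := by
  rcases mem_polyPiece_iff.1 hp with ⟨n, rfl, hn⟩ | rfl
  · rw [homComp_of_isHomogeneous hn, if_pos rfl]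
  · exact map_zero _

theorem homComp_eq_self_iff {z : ℤ} {p : Poly k d} : homComp z p = p ↔ p ∈ polyPiece k d z :=
  ⟨fun h => h ▸ homComp_mem z p, homComp_of_mem⟩

theorem homComp_homComp (z : ℤ) (p : Poly k d) : homComp z (homComp z p) = homComp z p :=
  homComp_of_mem (homComp_mem z p)

theorem sum_homComp (p : Poly k d) :
    ∑ i ∈ Finset.range (p.totalDegree + 1), homComp (i : ℤ) p = p := by
  simp only [homComp_natCast]
  exact sum_homogeneousComponent p

theorem homComp_mul {z e : ℤ} (p : Poly k d) {q : Poly k d} (hq : q ∈ polyPiece k d e) :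
    homComp z (p * q) = homComp (z - e) p * q := by
  rcases mem_polyPiece_iff.1 hq with ⟨n, rfl, hn⟩ | rfl
  · conv_lhs => rw [← sum_homComp p, Finset.sum_mul, map_sum]
    conv_rhs => rw [← sum_homComp p, map_sum, Finset.sum_mul]
    refine Finset.sum_congr rfl fun i _ => ?_
    have hi : (homComp (i : ℤ) p).IsHomogeneous i := by
      rw [homComp_natCast]; exact homogeneousComponent_isHomogeneous _ _
    rw [homComp_of_isHomogeneous (hi.mul hn), homComp_of_isHomogeneous hi, ite_mul, zero_mul]
    congr 1
    push_cast
    rw [sub_eq_iff_eq_add]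
  · simp

theorem homComp_mul_left {z e : ℤ} {p : Poly k d} (hp : p ∈ polyPiece k d e) (q : Poly k d) :
    homComp z (p * q) = p * homComp (z - e) q := by
  rw [mul_comm, homComp_mul _ hp, mul_comm]

theorem mem_polyPiece_of_isHomogeneous {n : ℕ} {p : Poly k d} (hp : p.IsHomogeneous n) :
    p ∈ polyPiece k d n :=
  mem_polyPiece_iff.2 (Or.inl ⟨n, rfl, hp⟩)

/-- An ideal closed under taking homogeneous components. -/
def IsHomog (J : Ideal (Poly k d)) : Prop := ∀ p ∈ J, ∀ z, homComp z p ∈ J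

theorem isHomog_span {S : Set (Poly k d)} (hS : ∀ p ∈ S, ∃ z, p ∈ polyPiece k d z) :
    IsHomog (Ideal.span S) := by
  intro p hp
  induction hp using Submodule.span_induction with
  | mem x hx =>
    intro z
    obtain ⟨e, he⟩ := hS x hx
    rw [← one_mul x, homComp_mul _ he]
    exact Ideal.mul_mem_left _ _ (Ideal.subset_span hx)
  | zero => simp
  | add x y _ _ h1 h2 => intro z; rw [map_add]; exact add_mem (h1 z) (h2 z)
  | smul a x _ h =>
    intro z
    rw [smul_eq_mul, ← sum_homComp a, Finset.sum_mul, map_sum]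
    refine sum_mem fun i _ => ?_
    rw [homComp_mul_left (homComp_mem _ _)]
    exact Ideal.mul_mem_left _ _ (h _)

theorem IsHomog.sup {J J' : Ideal (Poly k d)} (h : IsHomog J) (h' : IsHomog J') :
    IsHomog (J ⊔ J') := by
  intro p hp z
  obtain ⟨a, ha, b, hb, rfl⟩ := Submodule.mem_sup.1 hp
  rw [map_add]
  exact Submodule.add_mem_sup (h a ha z) (h' b hb z)

theorem LinearCoords.isHomog_linIdeal (ψ : LinearCoords k d) (p : ℕ) : IsHomog (ψ.linIdeal p) := by
  rw [linIdeal, powersIdeal_eq_span]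
  refine isHomog_span ?_
  rintro _ ⟨l, -, rfl⟩
  exact ⟨1, by simpa using mem_polyPiece_of_isHomogeneous (ψ.isHomogeneous_coord l)⟩

end GradedPieces

section Resolution

variable {d : ℕ}

theorem mem_smul_top_pi_iff {R : Type} [CommRing R] {m : ℕ} {q : Ideal R} {g : Fin m → R} :
    g ∈ q • (⊤ : Submodule R (Fin m → R)) ↔ ∀ s, g s ∈ q := by
  constructor
  · intro hg s
    induction hg using Submodule.smul_induction_on' with
    | smul a ha n _ => exact Ideal.mul_mem_right _ _ ha
    | add a _ b _ h1 h2 => exact add_mem h1 h2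
  · intro hg
    rw [← Finset.univ_sum_single g]
    refine sum_mem fun s _ => ?_
    rw [show Pi.single s (g s) = g s • (Pi.single s 1 : Fin m → R) by
      rw [← Pi.single_smul, smul_eq_mul, mul_one]]
    exact Submodule.smul_mem_smul (hg s) trivial

theorem map_apply_eq_sum {R : Type} [CommRing R] {m n : ℕ} (f : (Fin m → R) →ₗ[R] (Fin n → R))
    (g : Fin m → R) (i : Fin n) : f g i = ∑ s, g s * f (Pi.single s 1) i := by
  conv_lhs => rw [← Finset.univ_sum_single g, map_sum, Finset.sum_apply]
  refine Finset.sum_congr rfl fun s _ => ?_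
  rw [show Pi.single s (g s) = g s • (Pi.single s 1 : Fin m → R) by
    rw [← Pi.single_smul, smul_eq_mul, mul_one], map_smul]
  rfl

theorem homComp_map {m n : ℕ} {a : Fin m → ℤ} {b : Fin n → ℤ}
    {f : (Fin m → Poly k d) →ₗ[Poly k d] (Fin n → Poly k d)}
    (hf : ∀ s i, f (Pi.single s 1) i ∈ polyPiece k d (a s - b i)) (D : ℤ) (g : Fin m → Poly k d)
    (i : Fin n) : homComp (D - b i) (f g i) = f (fun s => homComp (D - a s) (g s)) i := by
  rw [map_apply_eq_sum, map_apply_eq_sum f fun s => homComp (D - a s) (g s), map_sum]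
  refine Finset.sum_congr rfl fun s _ => ?_
  rw [homComp_mul _ (hf s i), sub_sub_sub_cancel_right]

/-- The complex of free modules underlying a resolution. -/
def freeCplx {m : ℕ → ℕ}
    (dl : ∀ j, (Fin (m (j + 1)) → Poly k d) →ₗ[Poly k d] (Fin (m j) → Poly k d))
    (h : ∀ j, LinearMap.ker (dl j) = LinearMap.range (dl (j + 1))) : Cplx (Poly k d) where
  obj j := Fin (m j) → Poly k d
  d := dl
  d_d j g := by
    rw [← LinearMap.mem_ker, h]
    exact ⟨g, rfl⟩

/-- The grading on a complex of free modules. -/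
def freeGrading {m : ℕ → ℕ} (a : ∀ j, Fin (m j) → ℤ)
    (dl : ∀ j, (Fin (m (j + 1)) → Poly k d) →ₗ[Poly k d] (Fin (m j) → Poly k d))
    (h : ∀ j, LinearMap.ker (dl j) = LinearMap.range (dl (j + 1)))
    (ha : ∀ j (s : Fin (m (j + 1))) (i : Fin (m j)),
      dl j (Pi.single s 1) i ∈ polyPiece k d (a (j + 1) s - a j i))
    {L : Ideal (Poly k d)} (hL : IsHomog L) (y : ℕ → Poly k d)
    (hy : ∀ j, (y j).IsHomogeneous 1) : (freeCplx dl h).Grading L y where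
  proj j D :=
    { toFun := fun g s => homComp (D - a j s) (g s)
      map_zero' := funext fun s => map_zero _
      map_add' := fun g g' => funext fun s => map_add _ _ _ }
  proj_d j D g := funext fun i => homComp_map (ha j) D g i
  proj_smul i j D g := funext fun s => by
    have := homComp_mul_left (z := D + 1 - a i s)
      (mem_polyPiece_of_isHomogeneous (hy j)) (g s)
    refine this.trans ?_
    rw [show D + 1 - a i s - (1 : ℕ) = D - a i s by push_cast; ring]
    rfl
  proj_mem i D g hg := mem_smul_top_pi_iff.2 fun s => hL _ (mem_smul_top_pi_iff.1 hg s) _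
  proj_proj i D g := funext fun s => homComp_homComp _ _

/-- The irrelevant maximal ideal. -/
def irrel (k : Type) [Field k] (d : ℕ) : Ideal (Poly k d) :=
  Ideal.span (Set.range (MvPolynomial.X : Fin d → Poly k d))

/-- The class of `g` modulo `Q` is torsion with respect to the irrelevant ideal. -/
def IsTors (Q : Ideal (Poly k d)) (g : Poly k d) : Prop :=
  ∀ r ∈ irrel k d, ∃ s : ℕ, r ^ s * g ∈ Q

theorem isTors_iff_le_radical {Q : Ideal (Poly k d)} {g : Poly k d} :
    IsTors Q g ↔ irrel k d ≤ (Submodule.colon Q {g}).radical := by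
  simp only [IsTors, SetLike.le_def, Ideal.mem_radical_iff, Submodule.mem_colon_singleton,
    smul_eq_mul]

theorem isTors_of_X {Q : Ideal (Poly k d)} {g : Poly k d}
    (h : ∀ j, ∃ s : ℕ, (MvPolynomial.X j : Poly k d) ^ s * g ∈ Q) : IsTors Q g := by
  rw [isTors_iff_le_radical, irrel, Ideal.span_le]
  rintro _ ⟨j, rfl⟩
  obtain ⟨s, hs⟩ := h j
  exact ⟨s, by simpa [Submodule.mem_colon_singleton] using hs⟩

theorem isTors_iff_pow {Q : Ideal (Poly k d)} {g : Poly k d} :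
    IsTors Q g ↔ ∃ i : ℕ, ∀ y ∈ irrel k d ^ i, y * g ∈ Q := by
  constructor
  · intro h
    obtain ⟨n, hn⟩ := Ideal.exists_pow_le_of_le_radical_of_fg (isTors_iff_le_radical.1 h)
      (IsNoetherian.noetherian _)
    exact ⟨n, fun y hy => by simpa [Submodule.mem_colon_singleton] using hn hy⟩
  · rintro ⟨i, hi⟩ r hr
    exact ⟨i, hi _ (Ideal.pow_mem_pow hr i)⟩

theorem mem_irrel_of_isHomogeneous {g : Poly k d} {n : ℕ} (hn : n ≠ 0) (hg : g.IsHomogeneous n) :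
    g ∈ irrel k d := by
  rw [irrel, ← Set.image_univ, MvPolynomial.mem_ideal_span_X_image]
  intro e he
  by_contra! h
  refine hn ?_
  rw [← hg (MvPolynomial.mem_support_iff.1 he)]
  have : e = 0 := by ext j; simpa using h j trivial
  simp [this]

end Resolution

section Resolution

variable {d : ℕ}

/-- The first `c` coordinates are filter-regular on `R / I`. -/
def LinearCoords.FilterRegular (ψ : LinearCoords k d) (I : Ideal (Poly k d)) (c : ℕ) : Prop :=
  ∀ p < c, ∀ g, ψ.coord p * g ∈ I ⊔ ψ.linIdeal p → IsTors (I ⊔ ψ.linIdeal p) g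

theorem LinearCoords.linIdeal_succ (ψ : LinearCoords k d) {p : ℕ} (hp : p < d) :
    ψ.linIdeal (p + 1) = ψ.linIdeal p ⊔ Ideal.span {ψ.coord p} := by
  rw [linIdeal, ψ.powersIdeal_succ _ hp, pow_one, linIdeal]

theorem LinearCoords.coord_mem_irrel (ψ : LinearCoords k d) (p : ℕ) :
    ψ.coord p ∈ irrel k d :=
  mem_irrel_of_isHomogeneous one_ne_zero (ψ.isHomogeneous_coord p)

theorem LinearCoords.irrel_le_span (ψ : LinearCoords k d) :
    irrel k d ≤ Ideal.span (Set.range fun l : Fin d => ψ.coord l) := by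
  rw [irrel, Ideal.span_le]
  rintro _ ⟨l, rfl⟩
  have h := mem_irrel_of_isHomogeneous one_ne_zero
    (ψ.isHomogeneous_symm _ _ (MvPolynomial.isHomogeneous_X k l))
  have h' := Ideal.mem_map_of_mem ψ.toEquiv h
  rw [AlgEquiv.apply_symm_apply, irrel, Ideal.map_span, ← Set.range_comp] at h'
  rwa [show (fun l : Fin d => ψ.coord l) = ψ.toEquiv ∘ MvPolynomial.X from
    funext fun l => ψ.coord_val l]

theorem LinearCoords.isTors_of_coord (ψ : LinearCoords k d) {Q : Ideal (Poly k d)} {g : Poly k d}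
    (h : ∀ l < d, ∃ s : ℕ, ψ.coord l ^ s * g ∈ Q) : IsTors Q g := by
  rw [isTors_iff_le_radical]
  refine ψ.irrel_le_span.trans (Ideal.span_le.2 ?_)
  rintro _ ⟨l, rfl⟩
  obtain ⟨s, hs⟩ := h l l.2
  exact ⟨s, by simpa [Submodule.mem_colon_singleton] using hs⟩

theorem LinearCoords.coord_mem_linIdeal (ψ : LinearCoords k d) {l p : ℕ} (hlp : l < p)
    (hl : l < d) : ψ.coord l ∈ ψ.linIdeal p := by
  rw [linIdeal, powersIdeal_eq_span]
  exact Ideal.subset_span ⟨⟨l, hl⟩, hlp, pow_one _⟩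

/-- A graded free resolution of a cyclic module `R / I`, together with a degree-preserving lift to
`R` of the augmentation map. -/
structure CyclicResolution (I : Ideal (Poly k d)) (b : ℕ → ℤ) where
  m : ℕ → ℕ
  a : ∀ j, Fin (m j) → ℤ
  dl : ∀ j, (Fin (m (j + 1)) → Poly k d) →ₗ[Poly k d] (Fin (m j) → Poly k d)
  ε : (Fin (m 0) → Poly k d) →ₗ[Poly k d] Poly k d
  exists_one : ∃ u, ε u - 1 ∈ I
  mem_iff : ∀ v, ε v ∈ I ↔ ∃ h, dl 0 h = v
  exact : ∀ j, LinearMap.ker (dl j) = LinearMap.range (dl (j + 1))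
  dl_mem : ∀ j (s : Fin (m (j + 1))) (i : Fin (m j)),
    dl j (Pi.single s 1) i ∈ polyPiece k d (a (j + 1) s - a j i)
  homComp_ε : ∀ D v, homComp D (ε v) = ε fun s => homComp (D - a 0 s) (v s)
  ε_mem : ∀ q : Ideal (Poly k d), ∀ v, (∀ s, v s ∈ q) → ε v ∈ q
  le : ∀ j s, a j s ≤ b j

theorem exists_cyclicResolution {I : Ideal (Poly k d)} {b : ℕ → ℤ}
    (h : HasResolutionBddBy (k := k) (d := d) (Poly k d ⧸ I) (quotPiece I) b) : Nonempty (CyclicResolution I b) := by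
  obtain ⟨m, a, dl, π, ⟨h1, h2, h3, h4, h5⟩, h6⟩ := h
  choose p hp hpπ using h5
  let ε := Fintype.linearCombination (Poly k d) p
  have hε : ∀ v, Ideal.Quotient.mk I (ε v) = π v := by
    intro v
    conv_rhs => rw [← Finset.univ_sum_single v, map_sum]
    rw [Fintype.linearCombination_apply, map_sum]
    refine Finset.sum_congr rfl fun s _ => ?_
    rw [show Pi.single s (v s) = v s • (Pi.single s 1 : Fin (m 0) → Poly k d) by
      rw [← Pi.single_smul, smul_eq_mul, mul_one], π.map_smul, ← hpπ]
    rfl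
  refine ⟨⟨m, a, dl, ε, ?_, fun v => ?_, h3, h4, fun D v => ?_, fun q v hv => ?_, h6⟩⟩
  · obtain ⟨u, hu⟩ := h1 1
    exact ⟨u, by rw [← Ideal.Quotient.eq, hε, hu, map_one]⟩
  · rw [← Ideal.Quotient.eq_zero_iff_mem, hε, ← LinearMap.mem_ker, h2, LinearMap.mem_range]
  · rw [Fintype.linearCombination_apply, Fintype.linearCombination_apply, map_sum]
    exact Finset.sum_congr rfl fun s _ => homComp_mul _ (hp s)
  · rw [Fintype.linearCombination_apply]
    exact sum_mem fun s _ => Ideal.mul_mem_right _ _ (hv s)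

namespace CyclicResolution

variable {I : Ideal (Poly k d)} {b : ℕ → ℤ} (𝓕 : CyclicResolution I b)

/-- The complex of free modules underlying a resolution. -/
def cplx : Cplx (Poly k d) := freeCplx 𝓕.dl 𝓕.exact

theorem mem_bdry_iff {L : Ideal (Poly k d)} (v : Fin (𝓕.m 0) → Poly k d) :
    v ∈ 𝓕.cplx.bdry L 0 ↔ 𝓕.ε v ∈ I ⊔ L := by
  refine Cplx.mem_bdry.trans ?_
  constructor
  · rintro ⟨h, hh⟩
    have h1 : 𝓕.ε (v - 𝓕.dl 0 h) ∈ L := 𝓕.ε_mem L _ (mem_smul_top_pi_iff.1 hh)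
    have h2 : 𝓕.ε (𝓕.dl 0 h) ∈ I := (𝓕.mem_iff _).2 ⟨h, rfl⟩
    have h3 := Submodule.add_mem_sup h2 h1
    rw [← map_add] at h3
    rwa [add_sub_cancel] at h3
  · intro h
    obtain ⟨i, hi, l, hl, h⟩ := Submodule.mem_sup.1 h
    obtain ⟨u, hu⟩ := 𝓕.exists_one
    obtain ⟨h, hh⟩ : ∃ h, 𝓕.dl 0 h = v - l • u := by
      rw [← 𝓕.mem_iff, map_sub, map_smul, ← h, smul_eq_mul]
      have := sub_mem hi (Ideal.mul_mem_left _ l hu)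
      convert this using 1
      ring
    refine ⟨h, mem_smul_top_pi_iff.2 fun s => ?_⟩
    have : v - 𝓕.dl 0 h = l • u := by rw [hh]; abel
    change (v - 𝓕.dl 0 h) s ∈ L
    rw [this]
    exact Ideal.mul_mem_right _ _ hl

theorem torsionHomology {ψ : LinearCoords k d} {c : ℕ} (hc : c ≤ d)
    (hψ : ψ.FilterRegular I c) {r : Poly k d} (hr : r ∈ irrel k d) :
    𝓕.cplx.TorsionHomology (ψ.linIdeal c) r := by
  induction c with
  | zero =>
    intro i z hz
    rw [LinearCoords.linIdeal, LinearCoords.powersIdeal_zero, Submodule.bot_smul,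
      Submodule.mem_bot] at hz
    obtain ⟨h, hh⟩ := (𝓕.exact i).le hz
    refine ⟨0, Cplx.mem_bdry.2 ⟨h, ?_⟩⟩
    rw [show 𝓕.cplx.d (i + 1) h = z from hh, pow_zero, one_smul, sub_self]
    exact zero_mem _
  | succ c ih =>
    rw [ψ.linIdeal_succ (by omega)]
    refine (ih (by omega) fun p hp => hψ p (by omega)).sup_span_singleton ?_ ?_
    · intro i g hg
      refine mem_smul_top_pi_iff.2 fun s => ?_
      refine ψ.mem_powersIdeal_of_pow_mul_mem (t := 1) (by omega) ?_
      rw [pow_one]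
      exact mem_smul_top_pi_iff.1 hg s
    · intro g hg
      have := (𝓕.mem_bdry_iff _).1 hg
      have hg' := (congrArg (· ∈ I ⊔ ψ.linIdeal c) (map_smul 𝓕.ε (ψ.coord c) g)).mp this
      obtain ⟨s, hs⟩ := hψ c (by omega) _ hg' r hr
      refine ⟨s, (𝓕.mem_bdry_iff _).2 ?_⟩
      exact (congrArg (· ∈ I ⊔ ψ.linIdeal c) (map_smul 𝓕.ε (r ^ s) g)).mpr hs

theorem powRegular (ψ : LinearCoords k d) {c n : ℕ} (h : c + n ≤ d) :
    𝓕.cplx.PowRegular (ψ.linIdeal c) (fun l => ψ.coord (c + l)) n := by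
  intro i t j hj g hg
  refine mem_smul_top_pi_iff.2 fun s => ψ.mem_powIdeal_of_pow_mul_mem (t := t) (by omega) ?_
  exact mem_smul_top_pi_iff.1 hg s

/-- The grading on the complex underlying the resolution. -/
def grading (ψ : LinearCoords k d) (c : ℕ) :
    𝓕.cplx.Grading (ψ.linIdeal c) (fun l => ψ.coord (c + l)) :=
  freeGrading 𝓕.a 𝓕.dl 𝓕.exact 𝓕.dl_mem (ψ.isHomog_linIdeal c) _
    fun _ => ψ.isHomogeneous_coord _

theorem proj_mem (ψ : LinearCoords k d) {c n : ℕ} (h : c + n = d) (i : ℕ) {D : ℤ} (t : ℕ)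
    (hD : b i + n * ((t : ℤ) - 1) < D) (g : 𝓕.cplx.obj i) :
    (𝓕.grading ψ c).proj i D g ∈ powIdeal (ψ.linIdeal c) (fun l => ψ.coord (c + l)) t n •
      (⊤ : Submodule (Poly k d) (𝓕.cplx.obj i)) := by
  refine mem_smul_top_pi_iff.2 fun s => ?_
  change homComp (D - 𝓕.a i s) ((g : Fin (𝓕.m i) → Poly k d) s) ∈ _
  have ha := 𝓕.le i s
  rcases mem_polyPiece_iff.1 (homComp_mem (D - 𝓕.a i s) ((g : Fin (𝓕.m i) → Poly k d) s)) with
    ⟨N, hN, hg⟩ | h0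
  · exact ψ.mem_powIdeal_of_isHomogeneous h hg (by omega)
  · rw [h0]
    exact zero_mem _

theorem exists_lift {D : ℤ} {z : Poly k d} (hI : IsHomog I) (hz : z ∈ polyPiece k d D) :
    ∃ v : Fin (𝓕.m 0) → Poly k d, 𝓕.ε v - z ∈ I ∧
      (fun s => homComp (D - 𝓕.a 0 s) (v s)) = v := by
  obtain ⟨u, hu⟩ := 𝓕.exists_one
  refine ⟨fun s => homComp (D - 𝓕.a 0 s) ((z • u) s), ?_, ?_⟩
  · have := hI _ (Ideal.mul_mem_left _ z hu) D
    rwa [mul_sub, mul_one, map_sub, homComp_of_mem hz, ← smul_eq_mul, ← map_smul,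
      𝓕.homComp_ε] at this
  · exact funext fun s => homComp_homComp _ _

variable {ψ : LinearCoords k d}

include 𝓕 in
/-- Vanishing of the torsion of `R / (I + (ℓ₀, …, ℓ_{c-1}))` in high degrees. -/
theorem mem_of_isTors (hI : IsHomog I) {c n : ℕ} (h : c + n = d) (hψ : ψ.FilterRegular I c)
    {D : ℤ} (hD : b n - n < D) {z : Poly k d} (hz : z ∈ polyPiece k d D)
    (hzt : IsTors (I ⊔ ψ.linIdeal c) z) : z ∈ I ⊔ ψ.linIdeal c := by
  obtain ⟨v, hv, hvD⟩ := 𝓕.exists_lift hI hz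
  have key : v ∈ 𝓕.cplx.bdry (ψ.linIdeal c) 0 := by
    refine (𝓕.grading ψ c).mem_bdry_of_torsion (𝓕.powRegular ψ h.le)
      (fun j _ => 𝓕.torsionHomology (by omega) hψ (ψ.coord_mem_irrel _)) (D := D)
      (fun t g => 𝓕.proj_mem ψ h _ _ (by linarith) g) (fun j _ => ?_) hvD
    obtain ⟨s, hs⟩ := hzt _ (ψ.coord_mem_irrel (c + j))
    refine ⟨s, (𝓕.mem_bdry_iff _).2 ?_⟩
    refine (congrArg (· ∈ I ⊔ ψ.linIdeal c) (map_smul 𝓕.ε (ψ.coord (c + j) ^ s) v)).mpr ?_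
    have := add_mem hs (Ideal.mem_sup_left (Ideal.mul_mem_left I (ψ.coord (c + j) ^ s) hv))
    rwa [← mul_add, add_sub_cancel] at this
  have := sub_mem ((𝓕.mem_bdry_iff v).1 key) (Ideal.mem_sup_left hv)
  rwa [sub_sub_cancel] at this

include 𝓕 in
/-- In high degrees, the torsion of `R / (I + (ℓ₀, …, ℓ_{c-1}))` is generated from one degree
below. -/
theorem exists_mul_of_isTors (hI : IsHomog I) {c n : ℕ} (h : c + (n + 1) = d)
    (hψ : ψ.FilterRegular I c) {D : ℤ} (hD : b n - n < D) {z : Poly k d}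
    (hz : z ∈ polyPiece k d D) (hzt : IsTors (I ⊔ ψ.linIdeal c) z) :
    ∃ z' ∈ polyPiece k d (D - 1), IsTors (I ⊔ ψ.linIdeal c) z' ∧
      z - ψ.coord c * z' ∈ I ⊔ ψ.linIdeal c := by
  obtain ⟨v, hv, hvD⟩ := 𝓕.exists_lift hI hz
  obtain ⟨w, hw, hwt, hwD⟩ : ∃ w : Fin (𝓕.m 0) → Poly k d,
      v - ψ.coord c • w ∈ 𝓕.cplx.bdry (ψ.linIdeal c) 0 ∧
      (∀ j < n + 1, ∃ s : ℕ, ψ.coord (c + j) ^ s • w ∈ 𝓕.cplx.bdry (ψ.linIdeal c) 0) ∧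
      (fun s => homComp (D - 1 - 𝓕.a 0 s) (w s)) = w := (𝓕.grading ψ c).exists_smul_of_torsion (n := n)
    (𝓕.powRegular ψ h.le) (fun j _ => 𝓕.torsionHomology (by omega) hψ (ψ.coord_mem_irrel _))
    (D := D) (z := v)
    (fun t g => 𝓕.proj_mem ψ h _ _ (by push_cast; linarith) g) (fun j _ => by
      obtain ⟨s, hs⟩ := hzt _ (ψ.coord_mem_irrel (c + j))
      refine ⟨s, (𝓕.mem_bdry_iff _).2 ?_⟩
      refine (congrArg (· ∈ I ⊔ ψ.linIdeal c) (map_smul 𝓕.ε (ψ.coord (c + j) ^ s) v)).mpr ?_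
      have := add_mem hs (Ideal.mem_sup_left (Ideal.mul_mem_left I (ψ.coord (c + j) ^ s) hv))
      rwa [← mul_add, add_sub_cancel] at this) hvD
  refine ⟨𝓕.ε w, ?_, ψ.isTors_of_coord fun l hl => ?_, ?_⟩
  · rw [← homComp_eq_self_iff, 𝓕.homComp_ε, hwD]
  · rcases lt_or_ge l c with hlc | hlc
    · refine ⟨1, Ideal.mem_sup_right (Ideal.mul_mem_right _ _ ?_)⟩
      rw [pow_one]
      exact ψ.coord_mem_linIdeal hlc hl
    · obtain ⟨s, hs⟩ := hwt (l - c) (by omega)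
      rw [Nat.add_sub_cancel' hlc, 𝓕.mem_bdry_iff, map_smul] at hs
      exact ⟨s, hs⟩
  · have := sub_mem ((𝓕.mem_bdry_iff _).1 hw) (Ideal.mem_sup_left hv)
    rw [map_sub, map_smul, smul_eq_mul] at this
    convert this using 1
    ring

end CyclicResolution

end Resolution

section Specialization

open MvPolynomial

theorem exists_finset_subset_le {M : Type} [PartialOrder M] [WellQuasiOrderedLE M] (S : Set M) :
    ∃ T : Finset M, (T : Set M) ⊆ S ∧ ∀ x ∈ S, ∃ y ∈ T, y ≤ x := by
  have hpwo := Set.isPWO_of_wellQuasiOrderedLE S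
  have hfin : {x | Minimal (· ∈ S) x}.Finite :=
    (setOfPred_minimal_antichain _).finite_of_partiallyWellOrderedOn
      (hpwo.mono (setOfPred_minimal_subset _))
  refine ⟨hfin.toFinset, fun x hx => ?_, fun x hx => ?_⟩
  · exact ((Set.Finite.mem_toFinset hfin).1 hx).1
  · obtain ⟨z, hz, hz'⟩ := hpwo.exists_le_minimal hx
    exact ⟨z, (Set.Finite.mem_toFinset hfin).2 hz', hz⟩

/-- Outside the zero set of a suitable nonzero element `f`, an ideal `Q` of a polynomial ring
over a domain `B` meets the kernel of a specialization of `B` only in the obvious elements. -/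
theorem exists_pow_mul_mem_ker_mul {B : Type} [CommRing B] [IsDomain B] {d : ℕ}
    (Q : Ideal (MvPolynomial (Fin d) B)) : ∃ f : B, f ≠ 0 ∧
      ∀ (A : Type) [CommRing A] (ev : B →+* A), ∀ v ∈ Q, map ev v = 0 →
        ∃ N : ℕ, C f ^ N * v ∈ (RingHom.ker ev).map C * Q := by
  let m : MonomialOrder (Fin d) := MonomialOrder.lex
  obtain ⟨T, hTS, hT⟩ := exists_finset_subset_le {e | ∃ g ∈ Q, g ≠ 0 ∧ m.degree g = e}
  have hg : ∀ e : T, ∃ g ∈ Q, g ≠ 0 ∧ m.degree g = e := fun e => hTS e.2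
  choose g hgQ hg0 hge using hg
  refine ⟨∏ e, m.leadingCoeff (g e), Finset.prod_ne_zero_iff.2 fun e _ =>
    m.leadingCoeff_ne_zero_iff.2 (hg0 e), ?_⟩
  set f := ∏ e, m.leadingCoeff (g e) with hf
  intro A _ ev v hv hev
  induction hw : m.toSyn (m.degree v) using WellFoundedLT.induction generalizing v with
  | ind w ih =>
  by_cases hv0 : v = 0
  · exact ⟨0, by simp [hv0]⟩
  obtain ⟨e, he, hev'⟩ := hT (m.degree v) ⟨v, hv, hv0, rfl⟩
  obtain ⟨b, hb⟩ : m.leadingCoeff (g ⟨e, he⟩) ∣ f := Finset.dvd_prod_of_mem _ (Finset.mem_univ _)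
  have hker : m.leadingCoeff v ∈ RingHom.ker ev := by
    rw [RingHom.mem_ker, MonomialOrder.leadingCoeff, ← coeff_map, hev, coeff_zero]
  set q := monomial (m.degree v - e) (b * m.leadingCoeff v) * g ⟨e, he⟩ with hq
  have hqker : q ∈ (RingHom.ker ev).map C * Q := by
    refine Ideal.mul_mem_mul ?_ (hgQ _)
    rw [← mul_one (b * m.leadingCoeff v), ← C_mul_monomial]
    exact Ideal.mul_mem_right _ _ (Ideal.mem_map_of_mem _ (Ideal.mul_mem_left _ _ hker))
  have hqev : map ev q = 0 := by
    rw [hq, map_mul, map_monomial, map_mul, (RingHom.mem_ker).1 hker, mul_zero, monomial_zero,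
      zero_mul]
  obtain ⟨N, hN⟩ : ∃ N : ℕ, C f ^ N * (C f * v - q) ∈ (RingHom.ker ev).map C * Q := by
    by_cases hr : C f * v - q = 0
    · exact ⟨0, by simp [hr]⟩
    refine ih _ ?_ _ (sub_mem (Ideal.mul_mem_left _ _ hv) (Ideal.mul_mem_left _ _ (hgQ _)))
      (by rw [map_sub, map_mul, hev, hqev, mul_zero, sub_zero]) rfl
    have h1 : m.toSyn (m.degree (C f * v)) ≤ m.toSyn (m.degree v) := by
      have := m.degree_mul_le (f := C f) (g := v)
      rwa [m.degree_C, zero_add] at this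
    have h2 : m.toSyn (m.degree q) ≤ m.toSyn (m.degree v) := by
      have := m.degree_mul_le (f := monomial (m.degree v - e) (b * m.leadingCoeff v))
        (g := g ⟨e, he⟩)
      refine this.trans ?_
      rw [hge, map_add]
      refine (add_le_add_left (m.degree_monomial_le _) _).trans ?_
      rw [← map_add, tsub_add_cancel_of_le hev']
    have h3 : (C f * v - q).coeff (m.degree v) = 0 := by
      rw [coeff_sub, coeff_C_mul, hq]
      have h4 := coeff_monomial_mul e (m.degree v - e) (b * m.leadingCoeff v) (g ⟨e, he⟩)
      rw [tsub_add_cancel_of_le hev'] at h4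
      rw [h4, hb, MonomialOrder.leadingCoeff, MonomialOrder.leadingCoeff, hge]
      ring
    rw [← hw]
    refine lt_of_le_of_ne ((m.degree_sub_le).trans (sup_le h1 h2)) fun h4 => hr ?_
    rwa [← m.leadingCoeff_eq_zero_iff, MonomialOrder.leadingCoeff, m.toSyn.injective h4]
  refine ⟨N + 1, ?_⟩
  have := add_mem hN (Ideal.mul_mem_left _ (C f ^ N) hqker)
  convert this using 1
  ring

theorem exists_pow_mul_mem_of_forall_add_mem {S : Type} [CommRing S] {Q : Ideal S} {x y : S}
    {N : ℕ} {h : ℕ → S} (hN : h N = 0) (hQ : ∀ n, y * h (n + 1) + x * h n ∈ Q) :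
    ∃ s : ℕ, x ^ s * h 0 ∈ Q := by
  induction N generalizing h with
  | zero => exact ⟨0, by simp [hN]⟩
  | succ N ih =>
    obtain ⟨s, hs⟩ := ih (h := fun n => h (n + 1)) hN fun n => hQ (n + 1)
    refine ⟨s + 1, ?_⟩
    have := sub_mem (Ideal.mul_mem_left _ (x ^ s) (hQ 0)) (Ideal.mul_mem_left _ y hs)
    convert this using 1
    simp only [zero_add]
    ring

variable {d n : ℕ}

/-- The generic linear forms. -/
def genericForm (k : Type) [Field k] (d : ℕ) {n : ℕ} (i : Fin n) :
    MvPolynomial (Fin d) (MvPolynomial (Fin n × Fin d) k) :=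
  ∑ j, C (X (i, j)) * X j

/-- The extension of the ideal `I`, together with the first `p` generic linear forms. -/
def genericIdeal (I : Ideal (Poly k d)) (n p : ℕ) :
    Ideal (MvPolynomial (Fin d) (MvPolynomial (Fin n × Fin d) k)) :=
  I.map (map C) ⊔ Ideal.span (genericForm k d '' {i | i.1 < p})

/-- The translation of a single coefficient of a generic linear form. -/
def translateCoeff (k : Type) [Field k] {d n : ℕ} (p : Fin n) (j : Fin d) :
    MvPolynomial (Fin d) (MvPolynomial (Fin n × Fin d) k) →+*
      Polynomial (MvPolynomial (Fin d) (MvPolynomial (Fin n × Fin d) k)) :=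
  eval₂Hom (eval₂Hom (Polynomial.C.comp (C.comp C)) fun u =>
    Polynomial.C (C (X u)) + if u = (p, j) then Polynomial.X else 0) fun l => Polynomial.C (X l)

theorem translateCoeff_map_C (p : Fin n) (j : Fin d) (g : Poly k d) :
    translateCoeff k p j (map C g) = Polynomial.C (map C g) := by
  have : (translateCoeff k p j).comp (map C) = Polynomial.C.comp (map C) := by
    refine ringHom_ext (fun r => ?_) fun l => ?_ <;> simp [translateCoeff]
  exact RingHom.congr_fun this g

theorem coeff_zero_translateCoeff (p : Fin n) (j : Fin d)
    (g : MvPolynomial (Fin d) (MvPolynomial (Fin n × Fin d) k)) :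
    (translateCoeff k p j g).coeff 0 = g := by
  have : Polynomial.constantCoeff.comp (translateCoeff k p j) = RingHom.id _ := by
    refine ringHom_ext' (ringHom_ext (fun r => ?_) fun l => ?_) fun l => ?_
    · simp [translateCoeff]
    · by_cases h : l = (p, j) <;> simp [translateCoeff, h]
    · simp [translateCoeff]
  exact RingHom.congr_fun this g

theorem translateCoeff_genericForm (p i : Fin n) (j : Fin d) :
    translateCoeff k p j (genericForm k d i) =
      Polynomial.C (genericForm k d i) + if i = p then Polynomial.X * Polynomial.C (X j) else 0 := by
  simp only [translateCoeff, genericForm, map_sum, map_mul, eval₂Hom_C, eval₂Hom_X', add_mul,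
    Finset.sum_add_distrib]
  congr 1
  split_ifs with h
  · rw [Finset.sum_eq_single j]
    · simp [h]
    · intro l _ hl
      simp [hl]
    · simp
  · simp [h]

theorem exists_X_pow_mul_mem_genericIdeal {I : Ideal (Poly k d)} {p : Fin n}
    {a : MvPolynomial (Fin d) (MvPolynomial (Fin n × Fin d) k)}
    (ha : genericForm k d p * a ∈ genericIdeal I n p) (j : Fin d) :
    ∃ s : ℕ, X j ^ s * a ∈ genericIdeal I n p := by
  have hQ : genericIdeal I n p ≤
      ((genericIdeal I n p).map Polynomial.C).comap (translateCoeff k p j) := by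
    rw [genericIdeal, sup_le_iff, Ideal.map_le_iff_le_comap, Ideal.span_le]
    constructor
    · intro g hg
      rw [Ideal.mem_comap, Ideal.mem_comap, translateCoeff_map_C]
      exact Ideal.mem_map_of_mem _ (Ideal.mem_sup_left (Ideal.mem_map_of_mem _ hg))
    · rintro _ ⟨i, hi, rfl⟩
      have hip : i ≠ p := fun h => absurd (show i.1 < p.1 from hi) (by simp [h])
      rw [SetLike.mem_coe, Ideal.mem_comap, translateCoeff_genericForm, if_neg hip, add_zero]
      exact Ideal.mem_map_of_mem _ (Ideal.mem_sup_right (Ideal.subset_span ⟨i, hi, rfl⟩))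
  have h := hQ ha
  rw [Ideal.mem_comap, map_mul, translateCoeff_genericForm, if_pos rfl,
    Ideal.mem_map_C_iff] at h
  have h0 := exists_pow_mul_mem_of_forall_add_mem (Q := genericIdeal I n p) (x := X j)
    (y := genericForm k d p) (h := fun l => (translateCoeff k p j a).coeff l)
    (Polynomial.coeff_eq_zero_of_natDegree_lt (Nat.lt_succ_self _)) fun l => by
      have := h (l + 1)
      rwa [add_mul, Polynomial.coeff_add, Polynomial.coeff_C_mul, mul_assoc,
        Polynomial.coeff_X_mul, Polynomial.coeff_C_mul] at this
  simpa only [coeff_zero_translateCoeff] using h0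

end Specialization

section Generic

open MvPolynomial

variable {d n : ℕ}

/-- The linear forms with coefficient matrix `Λ`. -/
def linForm (Λ : Fin n → Fin d → k) (i : Fin n) : Poly k d := ∑ j, C (Λ i j) * X j

/-- The ideal generated by `I` and the first `p` linear forms with coefficient matrix `Λ`. -/
def specIdeal (I : Ideal (Poly k d)) (Λ : Fin n → Fin d → k) (p : ℕ) : Ideal (Poly k d) :=
  I ⊔ Ideal.span (linForm Λ '' {i | i.1 < p})

/-- The evaluation of the coefficients at the entries of `Λ`. -/
def specialize (Λ : Fin n → Fin d → k) : MvPolynomial (Fin n × Fin d) k →+* k :=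
  eval fun u => Λ u.1 u.2

theorem map_specialize_genericForm (Λ : Fin n → Fin d → k) (i : Fin n) :
    map (specialize Λ) (genericForm k d i) = linForm Λ i := by
  simp [genericForm, linForm, specialize]

theorem map_specialize_map_C (Λ : Fin n → Fin d → k) (g : Poly k d) :
    map (specialize Λ) (map C g) = g := by
  rw [map_map]
  convert map_id g
  ext
  simp [specialize]

theorem map_genericIdeal (I : Ideal (Poly k d)) (Λ : Fin n → Fin d → k) (p : ℕ) :
    (genericIdeal I n p).map (map (specialize Λ)) = specIdeal I Λ p := by
  rw [genericIdeal, specIdeal, Ideal.map_sup, Ideal.map_map, Ideal.map_span, Set.image_image]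
  simp only [map_specialize_genericForm]
  congr 1
  convert Ideal.map_id I
  exact RingHom.ext (map_specialize_map_C Λ)

theorem genericIdeal_succ (I : Ideal (Poly k d)) (p : Fin n) :
    genericIdeal I n (p + 1) = genericIdeal I n p ⊔ Ideal.span {genericForm k d p} := by
  have : {i : Fin n | i.1 < p.1 + 1} = insert p {i : Fin n | i.1 < p.1} := by
    ext i
    simp only [Set.mem_ofPred_eq, Set.mem_insert_iff, Fin.ext_iff]
    omega
  rw [genericIdeal, genericIdeal, this, Set.image_insert_eq, Ideal.span_insert, sup_assoc,
    sup_comm (Ideal.span _)]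

theorem exists_isTors_of_linForm_mul_mem (I : Ideal (Poly k d)) (p : Fin n) :
    ∃ f : MvPolynomial (Fin n × Fin d) k, f ≠ 0 ∧ ∀ Λ : Fin n → Fin d → k, specialize Λ f ≠ 0 →
      ∀ g, linForm Λ p * g ∈ specIdeal I Λ p → IsTors (specIdeal I Λ p) g := by
  obtain ⟨f, hf, H⟩ := exists_pow_mul_mem_ker_mul (genericIdeal I n (p + 1))
  refine ⟨f, hf, fun Λ hΛ g hg => isTors_of_X fun j => ?_⟩
  have hsurj : Function.Surjective (map (σ := Fin d) (specialize Λ)) := fun q =>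
    ⟨map C q, map_specialize_map_C Λ q⟩
  rw [← map_genericIdeal, Ideal.mem_map_iff_of_surjective _ hsurj] at hg
  obtain ⟨q, hq, hqg⟩ := hg
  obtain ⟨N, hN⟩ := H k (specialize Λ) (genericForm k d p * map C g - q)
    (by
      rw [genericIdeal_succ]
      exact sub_mem (Ideal.mem_sup_right (Ideal.mul_mem_right _ _ (Ideal.mem_span_singleton_self _)))
        (Ideal.mem_sup_left hq))
    (by rw [map_sub, map_mul, map_specialize_genericForm, map_specialize_map_C, hqg, sub_self])
  rw [genericIdeal_succ, Ideal.mul_sup] at hN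
  obtain ⟨a, ha, b, hb, hab⟩ := Submodule.mem_sup.1 hN
  obtain ⟨m, hm, rfl⟩ := Ideal.mem_mul_span_singleton.1 hb
  have hm0 : map (specialize Λ) m = 0 := by
    have : (RingHom.ker (specialize Λ)).map C ≤ RingHom.ker (map (σ := Fin d) (specialize Λ)) := by
      rw [Ideal.map_le_iff_le_comap]
      intro r hr
      rw [Ideal.mem_comap, RingHom.mem_ker, map_C, RingHom.mem_ker.1 hr, C_0]
    exact this hm
  have key : genericForm k d p * (C f ^ N * map C g - m) ∈ genericIdeal I n p := by
    have := add_mem (Ideal.mul_le_right ha) (Ideal.mul_mem_left _ (C f ^ N) hq)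
    convert this using 1
    linear_combination -hab
  obtain ⟨s, hs⟩ := exists_X_pow_mul_mem_genericIdeal key j
  refine ⟨s, ?_⟩
  have := Ideal.mem_map_of_mem (map (specialize Λ)) hs
  rw [map_genericIdeal, map_mul, map_sub, map_mul, map_specialize_map_C, hm0, sub_zero, map_pow,
    map_pow, map_X, map_C, ← C_pow] at this
  have h2 := Ideal.mul_mem_left _ (C ((specialize Λ f ^ N)⁻¹)) this
  convert h2 using 1
  rw [mul_left_comm (X j ^ s), ← mul_assoc, ← C_mul, inv_mul_cancel₀ (pow_ne_zero _ hΛ), C_1, one_mul]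

theorem exists_linearCoords (I : Ideal (Poly k d)) (hn : n ≤ d) :
    ∃ f : MvPolynomial (Fin n × Fin d) k, f ≠ 0 ∧ ∀ Λ : Fin n → Fin d → k, specialize Λ f ≠ 0 →
      ∃ ψ : LinearCoords k d, ψ.FilterRegular I n ∧ ∀ i : Fin n, ψ.coord i = linForm Λ i := by
  choose f hf H using exists_isTors_of_linForm_mul_mem (n := n) I
  let M : Matrix (Fin n) (Fin n) (MvPolynomial (Fin n × Fin d) k) :=
    Matrix.of fun i j => X (i, j.castLE hn)
  have hM (Λ : Fin n → Fin d → k) : specialize Λ M.det =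
      (Matrix.of fun i j : Fin n => Λ i (j.castLE hn)).det := by
    rw [RingHom.map_det]
    congr 1
    ext i j
    simp [M, specialize]
  have hM0 : M.det ≠ 0 := fun h => by
    have h1 := hM fun i j => if i.1 = j.1 then 1 else 0
    rw [h, map_zero, show (Matrix.of fun i j : Fin n => if i.1 = (j.castLE hn).1 then (1 : k) else 0) = 1
      by ext i j; simp [Matrix.one_apply, Fin.ext_iff], Matrix.det_one] at h1
    exact zero_ne_one h1
  refine ⟨M.det * ∏ i, f i, mul_ne_zero hM0 (Finset.prod_ne_zero_iff.2 fun i _ => hf i),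
    fun Λ hΛ => ?_⟩
  rw [map_mul, map_prod] at hΛ
  obtain ⟨ψ, hψ⟩ := LinearCoords.exists_coord_eq hn Λ (hM Λ ▸ left_ne_zero_of_mul hΛ)
  refine ⟨ψ, fun p hp g hg => ?_, hψ⟩
  have hlin : I ⊔ ψ.linIdeal p = specIdeal I Λ p := by
    rw [specIdeal, LinearCoords.linIdeal, LinearCoords.powersIdeal_eq_span]
    congr 2
    ext q
    constructor
    · rintro ⟨l, hl, rfl⟩
      exact ⟨⟨l, lt_trans hl hp⟩, hl, by
        rw [show linForm Λ ⟨l, lt_trans hl hp⟩ = _ from (hψ ⟨l, lt_trans hl hp⟩).symm]; simp⟩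
    · rintro ⟨l, hl, rfl⟩
      exact ⟨l.castLE hn, hl, by
        rw [show linForm Λ l = _ from (hψ l).symm]; simp⟩
  rw [hlin] at hg ⊢
  refine H ⟨p, hp⟩ Λ (Finset.prod_ne_zero_iff.1 (right_ne_zero_of_mul hΛ) _ (Finset.mem_univ _)) g ?_
  rwa [show linForm Λ ⟨p, hp⟩ = _ from (hψ ⟨p, hp⟩).symm]

theorem exists_linearCoords_extend [Infinite k] (I : Ideal (Poly k d)) (hn : n + 1 ≤ d) :
    ∃ f : MvPolynomial (Fin n × Fin d) k, f ≠ 0 ∧ ∀ Λ : Fin n → Fin d → k, specialize Λ f ≠ 0 →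
      ∃ ψ : LinearCoords k d, ψ.FilterRegular I (n + 1) ∧
        ψ.linIdeal n = Ideal.span (Set.range (linForm Λ)) := by
  obtain ⟨f, hf, H⟩ := exists_linearCoords (n := n + 1) I hn
  obtain ⟨x, hx⟩ : ∃ x, eval x f ≠ 0 := by
    by_contra! h
    exact hf (funext fun x => by rw [h, map_zero])
  let v : Fin (n + 1) × Fin d → MvPolynomial (Fin n × Fin d) k := fun u =>
    Fin.lastCases (C (x (Fin.last n, u.2))) (fun i => X (i, u.2)) u.1
  have hv (Λ : Fin n → Fin d → k) : specialize Λ (aeval v f) =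
      specialize (Fin.snoc Λ fun j => x (Fin.last n, j) : Fin (n + 1) → Fin d → k) f := by
    rw [specialize, specialize, ← aeval_eq_eval, ← aeval_eq_eval, ← AlgHom.comp_apply,
      comp_aeval]
    congr 2
    ext ⟨i, j⟩
    refine Fin.lastCases ?_ (fun i => ?_) i <;> simp [v]
  refine ⟨aeval v f, fun h => ?_, fun Λ hΛ => ?_⟩
  · have := hv fun i j => x (i.castSucc, j)
    rw [h, map_zero, specialize] at this
    refine hx ?_
    rw [this]
    congr 2
    ext ⟨i, j⟩
    refine Fin.lastCases ?_ (fun i => ?_) i <;> simp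
  · obtain ⟨ψ, hψ, hc⟩ := H _ (hv Λ ▸ hΛ)
    refine ⟨ψ, hψ, ?_⟩
    rw [LinearCoords.linIdeal, LinearCoords.powersIdeal_eq_span]
    have hc' (i : Fin n) : ψ.coord i = linForm Λ i := by
      have := hc i.castSucc
      simpa [linForm] using this
    congr 1
    ext q
    constructor
    · rintro ⟨l, hl, rfl⟩
      exact ⟨⟨l, hl⟩, by rw [← hc']; simp⟩
    · rintro ⟨l, rfl⟩
      exact ⟨l.castLE (by omega), l.2, by rw [← hc']; simp⟩

end Generic

section Dimension

variable {d : ℕ}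

theorem exists_pow_mul_mem_of_mem_minimalPrimes {R : Type} [CommRing R] {Q P : Ideal R}
    (hP : P ∈ Q.minimalPrimes) {x : R} (hx : x ∈ P) : ∃ g ∉ P, ∃ N : ℕ, x ^ N * g ∈ Q := by
  have := hP.1.1
  have hrad := IsLocalization.AtPrime.radical_map_of_mem_minimalPrimes
    (Localization.AtPrime P) P Q hP
  have hmem : algebraMap R (Localization.AtPrime P) x ∈
      (Q.map (algebraMap R (Localization.AtPrime P))).radical := by
    rw [hrad]
    exact Ideal.mem_map_of_mem _ hx
  obtain ⟨N, hN⟩ := hmem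
  rw [← map_pow, IsLocalization.algebraMap_mem_map_algebraMap_iff P.primeCompl] at hN
  obtain ⟨g, hg, hgN⟩ := hN
  exact ⟨g, hg, N, mul_comm g _ ▸ hgN⟩

theorem irrel_le_of_mem_minimalPrimes {Q P : Ideal (Poly k d)} (hP : P ∈ Q.minimalPrimes)
    {x : Poly k d} (hx : x ∈ P) (hQ : ∀ g, x * g ∈ Q → IsTors Q g) : irrel k d ≤ P := by
  have key (N : ℕ) (g : Poly k d) (hg : x ^ N * g ∈ Q) : IsTors Q g := by
    induction N generalizing g with
    | zero => exact fun r _ => ⟨0, by simpa using hg⟩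
    | succ N ih =>
      intro r hr
      obtain ⟨s, hs⟩ := hQ (x ^ N * g) (by rwa [← mul_assoc, ← pow_succ']) r hr
      obtain ⟨t, ht⟩ := ih (r ^ s * g) (by rwa [mul_left_comm]) r hr
      exact ⟨t + s, by rwa [pow_add, mul_assoc]⟩
  have := hP.1.1
  obtain ⟨g, hg, N, hN⟩ := exists_pow_mul_mem_of_mem_minimalPrimes hP hx
  intro r hr
  obtain ⟨s, hs⟩ := key N g hN r hr
  exact this.mem_of_pow_mem _ ((this.mem_or_mem (hP.1.2 hs)).resolve_right hg)

theorem ringKrullDim_quotient_add_one_le {R : Type} [CommRing R] {P P' : Ideal R} [P.IsPrime]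
    (h : P ≤ P') {x : R} (hx : x ∈ P') (hxP : x ∉ P) :
    ringKrullDim (R ⧸ P') + 1 ≤ ringKrullDim (R ⧸ P) := by
  refine ringKrullDim_succ_le_of_surjective (Ideal.Quotient.factor h)
    (Ideal.Quotient.factor_surjective h) (r := Ideal.Quotient.mk P x) ?_ ?_
  · exact mem_nonZeroDivisors_of_ne_zero fun h0 => hxP (Ideal.Quotient.eq_zero_iff_mem.1 h0)
  · rw [Ideal.Quotient.factor_mk]
    exact Ideal.Quotient.eq_zero_iff_mem.2 hx

theorem LinearCoords.FilterRegular.ringKrullDim_add_le {ψ : LinearCoords k d}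
    {I : Ideal (Poly k d)} {p : ℕ} (hψ : ψ.FilterRegular I p) (hp : p ≤ d) {P : Ideal (Poly k d)}
    [P.IsPrime] (hP : I ⊔ ψ.linIdeal p ≤ P) (hirr : ¬ irrel k d ≤ P) :
    ringKrullDim (Poly k d ⧸ P) + p ≤ ringKrullDim (Poly k d ⧸ I) := by
  induction p generalizing P with
  | zero =>
    rw [Nat.cast_zero, add_zero]
    exact ringKrullDim_le_of_surjective _
      (Ideal.Quotient.factor_surjective (le_sup_left.trans hP))
  | succ p ih =>
    rw [ψ.linIdeal_succ hp, ← sup_assoc, sup_le_iff, Ideal.span_singleton_le_iff_mem] at hP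
    obtain ⟨P₀, hP₀, hle⟩ := Ideal.exists_minimalPrimes_le hP.1
    have := hP₀.1.1
    have hx : ψ.coord p ∉ P₀ := fun h =>
      hirr ((irrel_le_of_mem_minimalPrimes hP₀ h (hψ p p.lt_succ_self)).trans hle)
    refine le_trans ?_ (ih (fun q hq => hψ q (hq.trans p.lt_succ_self)) (by omega) hP₀.1.2
      fun h => hirr (h.trans hle))
    rw [Nat.cast_succ, add_comm (p : WithBot ℕ∞), ← add_assoc]
    gcongr
    exact ringKrullDim_quotient_add_one_le hle hP.2 hx

theorem irrel_ne_top : irrel k d ≠ ⊤ := by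
  intro h
  have : irrel k d ≤ RingHom.ker (MvPolynomial.constantCoeff (R := k) (σ := Fin d)) := by
    rw [irrel, Ideal.span_le]
    rintro _ ⟨j, rfl⟩
    simp
  exact RingHom.ker_ne_top _ (top_le_iff.1 (h ▸ this))

theorem IsHomog.le_irrel {J : Ideal (Poly k d)} (hJ : IsHomog J) (h : J ≠ ⊤) : J ≤ irrel k d := by
  intro g hg
  rw [← sum_homComp g]
  refine sum_mem fun n _ => ?_
  rcases eq_or_ne n 0 with rfl | hn
  · have h0 := hJ g hg (0 : ℕ)
    rw [homComp_natCast, MvPolynomial.homogeneousComponent_zero] at h0 ⊢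
    by_cases hc : MvPolynomial.coeff 0 g = 0
    · simp [hc]
    · exact absurd (Ideal.eq_top_of_isUnit_mem _ h0 ((isUnit_iff_ne_zero.2 hc).map _)) h
  · rw [homComp_natCast]
    exact mem_irrel_of_isHomogeneous hn (MvPolynomial.homogeneousComponent_isHomogeneous n g)

attribute [local instance] MvPolynomial.gradedAlgebra in
theorem isHomog_iff {J : Ideal (Poly k d)} :
    IsHomog J ↔ J.IsHomogeneous (MvPolynomial.homogeneousSubmodule (Fin d) k) := by
  have (p : Poly k d) (n : ℕ) :
      (DirectSum.decompose (MvPolynomial.homogeneousSubmodule (Fin d) k) p n : Poly k d) =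
        MvPolynomial.homogeneousComponent n p :=
    MvPolynomial.decomposition.decompose'_apply p n
  constructor
  · intro h n p hp
    rw [this, ← homComp_natCast]
    exact h p hp n
  · intro h p hp z
    rcases lt_or_ge z 0 with hz | hz
    · rw [homComp_of_neg hz]
      exact J.zero_mem
    · lift z to ℕ using hz
      rw [homComp_natCast, ← this]
      exact h z hp

attribute [local instance] MvPolynomial.gradedAlgebra in
theorem LinearCoords.FilterRegular.irrel_le_radical {ψ : LinearCoords k d}
    {I : Ideal (Poly k d)} {e : ℕ} (hψ : ψ.FilterRegular I e) (he : e ≤ d) (hI : IsHomog I)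
    (hdim : ringKrullDim (Poly k d ⧸ I) = e) : irrel k d ≤ (I ⊔ ψ.linIdeal e).radical := by
  rw [(isHomog_iff.1 (hI.sup (ψ.isHomog_linIdeal e))).radical_eq]
  refine le_sInf ?_
  rintro P ⟨hPh, hIP, hP⟩
  by_contra hirr
  have h1 := hψ.ringKrullDim_add_le he hIP hirr
  obtain ⟨x, hx, hxP⟩ := SetLike.not_le_iff_exists.1 hirr
  have h2 := ringKrullDim_quotient_add_one_le ((isHomog_iff.2 hPh).le_irrel hP.ne_top) hx hxP
  have : Nontrivial (Poly k d ⧸ irrel k d) := Ideal.Quotient.nontrivial_iff.2 irrel_ne_top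
  have h3 : (1 : WithBot ℕ∞) ≤ ringKrullDim (Poly k d ⧸ P) :=
    le_trans (by simpa using add_le_add_left ringKrullDim_nonneg_of_nontrivial (1 : WithBot ℕ∞)) h2
  have h4 : (1 : WithBot ℕ∞) + e ≤ e := (add_le_add_left h3 _).trans (h1.trans hdim.le)
  have h5 : 1 + e ≤ e := by exact_mod_cast h4
  omega

theorem le_of_ringKrullDim_quotient_eq {I : Ideal (Poly k d)} {e : ℕ}
    (hdim : ringKrullDim (Poly k d ⧸ I) = e) : e ≤ d := by
  have := ringKrullDim_quotient_le I
  rw [hdim, MvPolynomial.ringKrullDim_of_isNoetherianRing, ringKrullDim_eq_zero_of_field, zero_add,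
    Nat.card_fin] at this
  exact_mod_cast this

end Dimension

section Generation

variable {d : ℕ}

theorem mem_comap_saturation_iff {I L : Ideal (Poly k d)} {g : Poly k d} :
    g ∈ Ideal.comap (Ideal.Quotient.mk L) (saturation (Ideal.map (Ideal.Quotient.mk L) I)
      (Ideal.map (Ideal.Quotient.mk L) (irrel k d))) ↔ IsTors (I ⊔ L) g := by
  rw [isTors_iff_pow]
  refine exists_congr fun i => ?_
  rw [← Ideal.map_pow]
  constructor
  · intro h y hy
    rw [← Ideal.mem_quotient_iff_mem_sup, map_mul]
    exact h _ (Ideal.mem_map_of_mem _ hy)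
  · intro h y hy
    obtain ⟨x, hx, rfl⟩ := (Ideal.mem_map_iff_of_surjective _ Ideal.Quotient.mk_surjective).1 hy
    rw [← map_mul, Ideal.mem_quotient_iff_mem_sup]
    exact h x hx

theorem IsTors.homComp {Q : Ideal (Poly k d)} (hQ : IsHomog Q) {g : Poly k d} (hg : IsTors Q g)
    (z : ℤ) : IsTors Q (homComp z g) := by
  refine isTors_of_X fun j => ?_
  obtain ⟨s, hs⟩ := hg _ (Ideal.subset_span ⟨j, rfl⟩)
  refine ⟨s, ?_⟩
  have h1 : (MvPolynomial.X j : Poly k d) ^ s ∈ polyPiece k d s :=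
    mem_polyPiece_of_isHomogeneous (by simpa using (MvPolynomial.isHomogeneous_X k j).pow s)
  have := hQ _ hs (z + s)
  rwa [homComp_mul_left h1, add_sub_cancel_right] at this

theorem isTors_of_mem {Q : Ideal (Poly k d)} {g : Poly k d} (hg : g ∈ Q) : IsTors Q g :=
  fun _ _ => ⟨0, by simpa using hg⟩

theorem isTors_of_isTors_mul {Q : Ideal (Poly k d)} {x g : Poly k d}
    (hx : ∀ g, x * g ∈ Q → IsTors Q g) (hg : IsTors Q (x * g)) : IsTors Q g := by
  intro r hr
  obtain ⟨s, hs⟩ := hg r hr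
  obtain ⟨t, ht⟩ := hx (r ^ s * g) (by rwa [mul_left_comm]) r hr
  exact ⟨t + s, by rwa [pow_add, mul_assoc]⟩

/-- A homogeneous ideal is contained in any ideal that contains its elements of degree at most `b`
and to which membership propagates from one degree to the next above `b`. -/
theorem IsHomog.le_of_forall {J M : Ideal (Poly k d)} (hJ : IsHomog J) (b : ℤ)
    (hb : ∀ D ≤ b, ∀ z ∈ polyPiece k d D, z ∈ J → z ∈ M)
    (hD : ∀ D, b < D → (∀ z ∈ polyPiece k d (D - 1), z ∈ J → z ∈ M) →
      ∀ z ∈ polyPiece k d D, z ∈ J → z ∈ M) : J ≤ M := by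
  have key (n : ℕ) (D : ℤ) (hn : D ≤ b + n) : ∀ z ∈ polyPiece k d D, z ∈ J → z ∈ M := by
    induction n generalizing D with
    | zero => exact hb D (by simpa using hn)
    | succ n ih =>
      rcases le_or_gt D b with h | h
      · exact hb D h
      · exact hD D h (ih (D - 1) (by push_cast at hn; omega))
  intro g hg
  rw [← sum_homComp g]
  exact sum_mem fun i _ => key (i - b).toNat i (by omega) _ (homComp_mem _ _) (hJ g hg _)

variable {I J : Ideal (Poly k d)} {b : ℕ → ℤ} {ψ : LinearCoords k d} {c n : ℕ}

namespace CyclicResolution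

variable (𝓕 : CyclicResolution I b)

include 𝓕 in
theorem le_sup_span (hI : IsHomog I) (h : c + (n + 1) = d)
    (hψ : ψ.FilterRegular I c) (hJ : ∀ g, g ∈ J ↔ IsTors (I ⊔ ψ.linIdeal c) g) {β : ℤ}
    (hβ : IdealGenDegLE I β) :
    J ≤ ψ.linIdeal c ⊔ Ideal.span ((J : Set (Poly k d)) ∩
      ⋃ (j : ℤ) (_ : j ≤ max β (b n - n)), (polyPiece k d j : Set (Poly k d))) := by
  have hQ := hI.sup (ψ.isHomog_linIdeal c)
  have hJh : IsHomog J := fun g hg z => (hJ _).2 (((hJ g).1 hg).homComp hQ z)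
  have hle : I ⊔ ψ.linIdeal c ≤ ψ.linIdeal c ⊔ Ideal.span ((J : Set (Poly k d)) ∩
      ⋃ (j : ℤ) (_ : j ≤ max β (b n - n)), (polyPiece k d j : Set (Poly k d))) := by
    refine sup_le (hβ.trans (le_sup_of_le_right (Ideal.span_mono ?_))) le_sup_left
    refine Set.inter_subset_inter (fun g hg => (hJ g).2 (isTors_of_mem (Ideal.mem_sup_left hg))) ?_
    exact Set.iUnion_mono fun j => Set.iUnion_mono' fun hj => ⟨hj.trans (le_max_left _ _), le_rfl⟩
  refine hJh.le_of_forall (max β (b n - n)) (fun D hD z hz hzJ => ?_) fun D hD ih z hz hzJ => ?_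
  · exact Ideal.mem_sup_right (Ideal.subset_span ⟨hzJ, Set.mem_iUnion₂.2 ⟨D, hD, hz⟩⟩)
  · obtain ⟨z', hz', hzt, hzz⟩ := 𝓕.exists_mul_of_isTors hI h hψ
      ((le_max_right _ _).trans_lt hD) hz ((hJ z).1 hzJ)
    rw [← sub_add_cancel z (ψ.coord c * z')]
    exact add_mem (hle hzz) (Ideal.mul_mem_left _ _ (ih z' hz' ((hJ z').2 hzt)))

include 𝓕 in
theorem le_sup_span_of_irrel_le_radical (hI : IsHomog I) (hItop : I ≠ ⊤) (h : c + (n + 1) = d)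
    (hψ : ψ.FilterRegular I (c + 1)) (hJ : ∀ g, g ∈ J ↔ IsTors (I ⊔ ψ.linIdeal c) g)
    (hrad : irrel k d ≤ (I ⊔ ψ.linIdeal (c + 1)).radical) :
    J ≤ ψ.linIdeal c ⊔ Ideal.span ((J : Set (Poly k d)) ∩
      ⋃ (j : ℤ) (_ : j ≤ b n - n + 1), (polyPiece k d j : Set (Poly k d))) := by
  have hQ := hI.sup (ψ.isHomog_linIdeal c)
  have hJh : IsHomog J := fun g hg z => (hJ _).2 (((hJ g).1 hg).homComp hQ z)
  have hmem (D : ℤ) (hD : b n - n < D) (w : Poly k d) (hw : w ∈ polyPiece k d D) :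
      w ∈ I ⊔ ψ.linIdeal (c + 1) := by
    refine 𝓕.mem_of_isTors hI (by omega) hψ hD hw fun r hr => ?_
    obtain ⟨s, hs⟩ := hrad hr
    exact ⟨s, Ideal.mul_mem_right _ _ hs⟩
  have hsucc : I ⊔ ψ.linIdeal (c + 1) = (I ⊔ ψ.linIdeal c) ⊔ Ideal.span {ψ.coord c} := by
    rw [ψ.linIdeal_succ (by omega), sup_assoc]
  have hbn : 0 ≤ b n - n := by
    by_contra! hneg
    refine irrel_ne_top (top_le_iff.1 fun g _ => ?_ : irrel k d = ⊤)
    have h1 := hmem 0 hneg 1 (mem_polyPiece_of_isHomogeneous (MvPolynomial.isHomogeneous_one _ _))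
    have hle : I ⊔ ψ.linIdeal (c + 1) ≤ irrel k d := by
      refine sup_le (hI.le_irrel hItop) ?_
      rw [LinearCoords.linIdeal, LinearCoords.powersIdeal_eq_span, Ideal.span_le]
      rintro _ ⟨l, -, rfl⟩
      simpa using ψ.coord_mem_irrel l
    simpa using Ideal.mul_mem_left _ g (hle h1)
  refine hJh.le_of_forall (b n - n + 1) (fun D hD z hz hzJ => ?_) fun D hD ih z hz hzJ => ?_
  · exact Ideal.mem_sup_right (Ideal.subset_span ⟨hzJ, Set.mem_iUnion₂.2 ⟨D, hD, hz⟩⟩)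
  have hzirr : z ∈ irrel k d := by
    rcases mem_polyPiece_iff.1 hz with ⟨m, rfl, hm⟩ | rfl
    · exact mem_irrel_of_isHomogeneous (by omega) hm
    · exact zero_mem _
  have hX (j : Fin d) : (MvPolynomial.X j : Poly k d) ∈ polyPiece k d 1 :=
    mem_polyPiece_of_isHomogeneous (MvPolynomial.isHomogeneous_X k j)
  obtain ⟨w, hw⟩ := Ideal.mem_span_range_iff_exists_fun.1 hzirr
  have hz' : ∑ i, homComp (D - 1) (w i) * MvPolynomial.X i = z := by
    rw [← homComp_of_mem hz, ← hw, map_sum]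
    exact Finset.sum_congr rfl fun i _ => (homComp_mul _ (hX i)).symm
  have hdec (i : Fin d) : ∃ q ∈ I ⊔ ψ.linIdeal c, ∃ a, q + a * ψ.coord c = homComp (D - 1) (w i) := by
    have := hmem (D - 1) (by omega) _ (homComp_mem _ (w i))
    rw [hsucc] at this
    obtain ⟨q, hq, _, hr, hqr⟩ := Submodule.mem_sup.1 this
    obtain ⟨a, rfl⟩ := Ideal.mem_span_singleton'.1 hr
    exact ⟨q, hq, a, hqr⟩
  choose q hq a ha using hdec
  have hsum : z = ∑ i, q i * MvPolynomial.X i + ψ.coord c * ∑ i, a i * MvPolynomial.X i := by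
    rw [← hz', Finset.mul_sum, ← Finset.sum_add_distrib]
    refine Finset.sum_congr rfl fun i _ => ?_
    rw [← ha]
    ring
  have hqJ (i : Fin d) : q i ∈ J := (hJ _).2 (isTors_of_mem (hq i))
  have haJ : ∑ i, a i * MvPolynomial.X i ∈ J := by
    refine (hJ _).2 (isTors_of_isTors_mul (hψ c c.lt_succ_self) ((hJ _).1 ?_))
    rw [eq_sub_of_add_eq' hsum.symm]
    exact sub_mem hzJ (sum_mem fun i _ => Ideal.mul_mem_right _ _ (hqJ i))
  rw [← homComp_of_mem hz, hsum, map_add, map_sum,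
    homComp_mul_left (mem_polyPiece_of_isHomogeneous (ψ.isHomogeneous_coord c))]
  refine add_mem (sum_mem fun i _ => ?_)
    (Ideal.mul_mem_left _ _ (ih _ (homComp_mem _ _) (hJh _ haJ _)))
  rw [homComp_mul _ (hX i)]
  exact Ideal.mul_mem_right _ _ (ih _ (homComp_mem _ _) (hJh _ (hqJ i) _))

end CyclicResolution

end Generation

theorem statement13
    (hk : Infinite k)
    (d : ℕ) (I : Ideal (Poly k d))
    (hIhom : ∀ p ∈ I, ∀ n : ℕ, MvPolynomial.homogeneousComponent n p ∈ I)
    -- `e = dim (R/I)` and `1 ≤ c ≤ dim(R/I) − 1`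
    (e : ℕ) (hdim : ringKrullDim (Poly k d ⧸ I) = (e : WithBot (WithTop ℕ)))
    (c : ℕ) (hc1 : 1 ≤ c) (hc2 : c + 1 ≤ e) :
    -- `ℓ₁,…,ℓ_c` are *general* linear forms: there is a nonzero polynomial in the
    -- coefficient matrix such that the conclusions hold whenever it does not vanish
    ∃ f : MvPolynomial (Fin c × Fin d) k, f ≠ 0 ∧
      ∀ Λ : Fin c → Fin d → k,
        MvPolynomial.eval (fun p : Fin c × Fin d => Λ p.1 p.2) f ≠ 0 →
        -- `L = (ℓ₁,…,ℓ_c)`, with `ℓᵢ = Σⱼ Λᵢⱼ xⱼ`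
        ∀ β : ℤ, ∀ cres : ℕ → ℤ,
          -- `b₀(I) ≤ β`
          IdealGenDegLE (k := k) (d := d) I β →
          -- `b_j(R/I) ≤ cres j` for all `j`; in particular
          -- `b_{d-c-2}(I) = b_{d-c-1}(R/I) ≤ cres (d-c-1)`
          HasResolutionBddBy (k := k) (d := d) (Poly k d ⧸ I) (quotPiece I) cres →
          -- the saturated ideal `J = Ī^sat ⊆ R̄`, expressed via its preimage in `R`:
          -- with `L = span(ℓ₁,…,ℓ_c)`, `𝔪 = (x₁,…,x_d)`,
          -- `J' = preimage of (Ī)^sat` satisfies the generator-degree bounds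
          (letI L : Ideal (Poly k d) := Ideal.span (Set.range fun i : Fin c =>
              ∑ j : Fin d, MvPolynomial.C (Λ i j) * MvPolynomial.X j)
           letI J' : Ideal (Poly k d) := Ideal.comap (Ideal.Quotient.mk L)
              (saturation (Ideal.map (Ideal.Quotient.mk L) I)
                (Ideal.map (Ideal.Quotient.mk L)
                  (Ideal.span (Set.range (MvPolynomial.X : Fin d → Poly k d)))))
           -- `b₀(J) ≤ max{ b₀(I), b_{d-c-2}(I) − d + c + 1 }`
           (J' ≤ L ⊔ Ideal.span ((J' : Set (Poly k d)) ∩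
              ⋃ (j : ℤ) (_ : j ≤ max β (cres (d - c - 1) - (d : ℤ) + c + 1)),
                (polyPiece k d j : Set (Poly k d))))
           -- and if `c = dim(R/I) − 1` then `b₀(J) ≤ b_{d-c-2}(I) − d + c + 2`
           ∧ (c + 1 = e →
              J' ≤ L ⊔ Ideal.span ((J' : Set (Poly k d)) ∩
                ⋃ (j : ℤ) (_ : j ≤ cres (d - c - 1) - (d : ℤ) + c + 2),
                  (polyPiece k d j : Set (Poly k d))))) := by
  have hed := le_of_ringKrullDim_quotient_eq hdim
  obtain ⟨f, hf, H⟩ := exists_linearCoords_extend I (hc2.trans hed)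
  refine ⟨f, hf, fun Λ hΛ β cres hβ hres => ?_⟩
  obtain ⟨ψ, hψ, hL⟩ := H Λ hΛ
  obtain ⟨𝓕⟩ := exists_cyclicResolution hres
  obtain ⟨n, hn⟩ : ∃ n, c + (n + 1) = d := ⟨d - c - 1, by omega⟩
  have hI : IsHomog I := fun p hp z => by
    rcases lt_or_ge z 0 with hz | hz
    · rw [homComp_of_neg hz]
      exact I.zero_mem
    · lift z to ℕ using hz
      rw [homComp_natCast]
      exact hIhom p hp z
  have hItop : I ≠ ⊤ := by
    rintro rfl
    have : Subsingleton (Poly k d ⧸ (⊤ : Ideal (Poly k d))) := Ideal.Quotient.subsingleton_iff.2 rfl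
    rw [ringKrullDim_eq_bot_of_subsingleton] at hdim
    exact WithBot.bot_ne_coe hdim
  have hL' : Ideal.span (Set.range fun i : Fin c => ∑ j : Fin d,
      (MvPolynomial.C (Λ i j) * MvPolynomial.X j : Poly k d)) = ψ.linIdeal c := hL.symm
  have hJ (g : Poly k d) := mem_comap_saturation_iff (I := I) (L := ψ.linIdeal c) (g := g)
  rw [hL', show d - c - 1 = n by omega]
  constructor
  · rw [show cres n - (d : ℤ) + c + 1 = cres n - n by omega]
    exact 𝓕.le_sup_span hI hn (fun p hp => hψ p (hp.trans c.lt_succ_self)) hJ hβ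
  · rintro rfl
    rw [show cres n - (d : ℤ) + c + 2 = cres n - n + 1 by omega]
    exact 𝓕.le_sup_span_of_irrel_le_radical hI hItop hn hψ hJ (hψ.irrel_le_radical hed hI hdim)

end Paper
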